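/- There exists a universal constant C > 0 (independent of ε and F) such that for every ε > 0, every F ∈ (1, ∞), every choice of sign ±, and every Schwartz function f on ℝ × ℝ³, the function v(t,x) = ∫_0^t ( ∫_{ℝ³} exp(i x·ξ ± i ((t−t')/ε) p_F(ξ)) (𝓕_x f(t',·))(ξ) dξ ) dt' satisfies ‖v‖_{L⁶(ℝ_t × ℝ³_x)} ≤ C ε^{1/6} F^{1/2} (F − 1)^{−1/6} ∫_ℝ ‖f(t',·)‖_{Ḣ¹} dt'. -/

import Mathlib

open MeasureTheory Complex
open scoped ENNReal RealInnerProductSpace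

noncomputable section

/-- Fourier transform `f̂(ξ) = ∫ e^{-i x·ξ} f(x) dx` on `ℝⁿ`. -/
def fourierTf {n : ℕ} (f : EuclideanSpace ℝ (Fin n) → ℂ) (ξ : EuclideanSpace ℝ (Fin n)) : ℂ :=
  ∫ x : EuclideanSpace ℝ (Fin n), Complex.exp (-Complex.I * Complex.ofReal ⟪x, ξ⟫) * f x

/-- Homogeneous Sobolev norm `‖f‖_{Ḣˢ}` on `ℝⁿ`. -/
def sobolevNorm {n : ℕ} (s : ℝ) (f : EuclideanSpace ℝ (Fin n) → ℂ) : ℝ :=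
  (∫ ξ : EuclideanSpace ℝ (Fin n), ‖ξ‖ ^ (2 * s) * ‖fourierTf f ξ‖ ^ 2) ^ (1 / 2 : ℝ)

/-- The dispersion relation `p_F(ξ) = |ξ|_F / (F |ξ|)`. -/
def pF (F : ℝ) (ξ : EuclideanSpace ℝ (Fin 3)) : ℝ :=
  Real.sqrt ((ξ 0) ^ 2 + (ξ 1) ^ 2 + (F * ξ 2) ^ 2) / (F * ‖ξ‖)


lemma lint_comp_smul {E : Type*} [NormedAddCommGroup E] [NormedSpace ℝ E] [FiniteDimensional ℝ E]
    [MeasureSpace E] [BorelSpace E] [(volume : Measure E).IsAddHaarMeasure]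
    {f : E → ℝ≥0∞} (hf : Measurable f) {r : ℝ} (hr : r ≠ 0) :
    ∫⁻ x : E, f (r • x) = ENNReal.ofReal |(r ^ Module.finrank ℝ E)⁻¹| * ∫⁻ x, f x := by
  have := Measure.map_addHaar_smul (volume : Measure E) hr
  rw [← lintegral_map (f := f) hf (measurable_const_smul r), this, lintegral_smul_measure, smul_eq_mul]

section Plancherel
open FourierTransform SchwartzMap

lemma plancherel_aux (φ : ℝ → ℂ) (h1 : Integrable φ) (h2 : MemLp φ 2) :
    eLpNorm (𝓕 φ) 2 volume = eLpNorm φ 2 volume := by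
  set g : Lp ℂ 2 (volume : Measure ℝ) := 𝓕 (h2.toLp φ) with hg
  have hcont : Continuous (𝓕 φ) := by
    exact (VectorFourier.fourierIntegral_continuous Real.continuous_fourierChar
      (by exact continuous_inner) h1)
  have hloc : LocallyIntegrable (g : ℝ → ℂ) volume :=
    (Lp.memLp g).locallyIntegrable (by norm_num)
  have hae : ∀ᵐ x, (g : ℝ → ℂ) x = 𝓕 φ x := by
    apply ae_eq_of_integral_contDiff_smul_eq hloc hcont.locallyIntegrable
    intro u hu hus
    have hu' : HasCompactSupport (fun x => (u x : ℂ)) := hus.comp_left (g := fun x : ℝ => (x : ℂ)) (by simp)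
    have hud : ContDiff ℝ (⊤ : ℕ∞) (fun x => (u x : ℂ)) := Complex.ofRealCLM.contDiff.comp hu
    set ψ : 𝓢(ℝ, ℂ) := hu'.toSchwartzMap hud with hψ
    have e1 := congrArg (fun T => T ψ) (Lp.fourier_toTemperedDistribution_eq (h2.toLp φ))
    simp only [TemperedDistribution.fourier_apply, Lp.toTemperedDistribution_apply] at e1
    have e2 : ∫ x, u x • (g : ℝ → ℂ) x = ∫ x, ψ x • (g : ℝ → ℂ) x := by
      apply integral_congr_ae; filter_upwards with x; rw [Complex.real_smul, smul_eq_mul]; rfl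
    have e3 : ∫ x, u x • 𝓕 φ x = ∫ x, ψ x • 𝓕 φ x := by
      apply integral_congr_ae; filter_upwards with x; rw [Complex.real_smul, smul_eq_mul]; rfl
    rw [e2, e3, ← e1]
    have e4 : ∫ x, (𝓕 ψ) x • (h2.toLp φ : ℝ → ℂ) x = ∫ x, (𝓕 (ψ : ℝ → ℂ)) x • φ x := by
      apply integral_congr_ae; filter_upwards [h2.coeFn_toLp] with x hx; rw [hx]; rfl
    rw [e4]
    have := VectorFourier.integral_fourierIntegral_smul_eq_flip (μ := (volume : Measure ℝ)) (ν := (volume : Measure ℝ)) (f := (ψ : ℝ → ℂ)) (g := φ)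
      (e := Real.fourierChar) (L := innerₗ ℝ) Real.continuous_fourierChar (by exact continuous_inner) ψ.integrable h1
    rw [flip_innerₗ] at this
    exact this
  calc eLpNorm (𝓕 φ) 2 volume = eLpNorm (g : ℝ → ℂ) 2 volume := 
        (eLpNorm_congr_ae hae).symm
    _ = eLpNorm (h2.toLp φ : ℝ → ℂ) 2 volume := by
        rw [← Lp.enorm_def, ← Lp.enorm_def, hg, ← ofReal_norm, ← ofReal_norm, Lp.norm_fourier_eq]
    _ = _ := eLpNorm_congr_ae h2.coeFn_toLp

lemma plancherel_lint (φ : ℝ → ℂ) (h1 : Integrable φ) (h2 : MemLp φ 2) :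
    ∫⁻ ρ : ℝ, ‖∫ τ : ℝ, Complex.exp (-Complex.I * ((ρ * τ : ℝ) : ℂ)) * φ τ‖ₑ ^ 2
      = ENNReal.ofReal (2 * Real.pi) * ∫⁻ τ, ‖φ τ‖ₑ ^ 2 := by
  have h := plancherel_aux φ h1 h2
  rw [eLpNorm_eq_lintegral_rpow_enorm_toReal (by norm_num) (by norm_num),
    eLpNorm_eq_lintegral_rpow_enorm_toReal (by norm_num) (by norm_num)] at h
  simp only [ENNReal.toReal_ofNat, ENNReal.rpow_ofNat] at h
  have h' := ENNReal.rpow_left_injective (by norm_num : (1/2:ℝ) ≠ 0) h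
  have hs : ∀ ρ : ℝ, ∫ τ : ℝ, Complex.exp (-Complex.I * ((ρ * τ : ℝ) : ℂ)) * φ τ
      = 𝓕 φ ((2 * Real.pi)⁻¹ * ρ) := by
    intro ρ
    rw [Real.fourier_real_eq_integral_exp_smul]
    congr 1; ext τ
    rw [smul_eq_mul]
    congr 2
    have : (Real.pi : ℂ) ≠ 0 := by exact_mod_cast Real.pi_ne_zero
    push_cast
    field_simp
  simp_rw [hs]
  rw [← h']
  have hcont : Continuous (𝓕 φ) := 
    (VectorFourier.fourierIntegral_continuous Real.continuous_fourierChar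
      (by exact continuous_inner) h1)
  have := lint_comp_smul (E := ℝ) (f := fun x => ‖𝓕 φ x‖ₑ ^ 2) (by fun_prop)
    (r := (2 * Real.pi)⁻¹) (by positivity)
  simp only [smul_eq_mul] at this
  rw [this]
  congr 2
  rw [Module.finrank_self, pow_one, inv_inv, abs_of_pos (by positivity)]
end Plancherel


section Osc

lemma osc_mid {c l S δ M : ℝ} (hc : 0 < c) (hl : 0 < l) (hcl : c ^ 2 + l ≤ 1) (hS : S ≠ 0)
    (hδ : 0 < δ) (hδM : δ ≤ M) (hM : M ≤ 1 / δ) :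
    ‖∫ v in δ..M, Complex.exp (Complex.I * ((S * Real.sqrt (c ^ 2 + l / (1 + v ^ 2)) : ℝ) : ℂ)) *
      ((1 / (1 + v ^ 2) : ℝ) : ℂ)‖ ≤ 7 * (1 / (c * |S| * l)) / δ := by
  have hc1 : c ≤ 1 := by nlinarith
  have hl1 : l ≤ 1 := by nlinarith
  have hδ1 : δ ≤ 1 / δ := hδM.trans hM
  set ψ : ℝ → ℝ := fun v => Real.sqrt (c ^ 2 + l / (1 + v ^ 2)) with hψ
  set ψ' : ℝ → ℝ := fun v => -(l * v) / ((1 + v ^ 2) ^ 2 * ψ v) with hψ'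
  have hpos : ∀ v : ℝ, 0 < c ^ 2 + l / (1 + v ^ 2) := fun v => by positivity
  have hψc : ∀ v, c ≤ ψ v := fun v => by
    apply Real.le_sqrt_of_sq_le
    have : 0 ≤ l / (1 + v ^ 2) := by positivity
    linarith
  have hψ0 : ∀ v, 0 < ψ v := fun v => hc.trans_le (hψc v)
  have hψ1 : ∀ v, ψ v ≤ 1 := fun v => by
    rw [hψ]; simp only
    rw [Real.sqrt_le_left zero_le_one, one_pow]
    have : l / (1 + v ^ 2) ≤ l := div_le_self hl.le (by nlinarith [sq_nonneg v])
    linarith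
  have hdψ : ∀ v, HasDerivAt ψ (ψ' v) v := fun v => by
    have h1 : HasDerivAt (fun v : ℝ => c ^ 2 + l / (1 + v ^ 2)) (-(l * (2 * v)) / (1 + v ^ 2) ^ 2) v := by
      have h0 : HasDerivAt (fun v : ℝ => 1 + v ^ 2) (2 * v) v := by
        simpa using (hasDerivAt_pow 2 v).const_add 1
      have := ((hasDerivAt_const v l).fun_div h0 (by positivity)).const_add (c ^ 2)
      exact this.congr_deriv (by ring)
    have := h1.sqrt (hpos v).ne'
    convert this using 1
    have := (hψ0 v).ne'
    simp only [hψ'] 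
    change _ = _ / (2 * ψ v)
    field_simp
  set g : ℝ → ℝ := fun v => (v + v⁻¹) * ψ v with hg
  set g' : ℝ → ℝ := fun v => (1 + -(v ^ 2)⁻¹) * ψ v + (v + v⁻¹) * ψ' v with hg'
  have hdg : ∀ v, 0 < v → HasDerivAt g (g' v) v := fun v hv => by
    exact ((hasDerivAt_id v).add (hasDerivAt_inv hv.ne')).mul (hdψ v)
  set e : ℝ → ℂ := fun v => Complex.exp (Complex.I * ((S * ψ v : ℝ) : ℂ)) with he
  have hen : ∀ v, ‖e v‖ = 1 := fun v => by
    simp only [he]; rw [mul_comm]; exact Complex.norm_exp_ofReal_mul_I _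
  have hde : ∀ v, HasDerivAt e (e v * (Complex.I * ((S * ψ' v : ℝ) : ℂ))) v := fun v => by
    exact ((((hdψ v).const_mul S).ofReal_comp).const_mul Complex.I).cexp
  have hψcont : Continuous ψ := continuous_iff_continuousAt.2 fun v => (hdψ v).continuousAt
  have hecont : Continuous e := continuous_iff_continuousAt.2 fun v => (hde v).continuousAt
  have hψ'cont : Continuous ψ' := by
    simp only [hψ']
    refine Continuous.div (by fun_prop) (by fun_prop) fun v => ?_
    have := hψ0 v; positivity
  have hsub : ∀ v ∈ Set.uIcc δ M, 0 < v := fun v hv => by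
    rw [Set.uIcc_of_le hδM] at hv; exact hδ.trans_le hv.1
  have hg'cont : ContinuousOn g' (Set.uIcc δ M) := by
    have : ContinuousOn (fun v : ℝ => v⁻¹) (Set.uIcc δ M) :=
      continuousOn_inv₀.mono fun v hv => (hsub v hv).ne'
    have h2 : ContinuousOn (fun v : ℝ => (v ^ 2)⁻¹) (Set.uIcc δ M) := by
      apply ContinuousOn.inv₀ (by fun_prop); intro v hv; have := hsub v hv; positivity
    fun_prop
  have ibp := intervalIntegral.integral_mul_deriv_eq_deriv_mul (a := δ) (b := M)
    (u := fun v => (g v : ℂ)) (u' := fun v => (g' v : ℂ)) (v := e)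
    (v' := fun v => e v * (Complex.I * ((S * ψ' v : ℝ) : ℂ)))
    (fun v hv => (hdg v (hsub v hv)).ofReal_comp) (fun v _ => hde v)
    (ContinuousOn.intervalIntegrable (by fun_prop)) (Continuous.intervalIntegrable (by fun_prop) _ _)
  have hL : ∫ v in δ..M, (g v : ℂ) * (e v * (Complex.I * ((S * ψ' v : ℝ) : ℂ)))
      = (-Complex.I * S * l) * ∫ v in δ..M, e v * ((1 / (1 + v ^ 2) : ℝ) : ℂ) := by
    rw [← intervalIntegral.integral_const_mul]
    apply intervalIntegral.integral_congr
    intro v hv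
    have hv0 := hsub v hv
    have key : g v * ψ' v = -l * (1 / (1 + v ^ 2)) := by
      simp only [hg, hψ']
      have := (hψ0 v).ne'
      field_simp
      ring
    have key' : (g v : ℂ) * (ψ' v : ℂ) = -l * ((1 / (1 + v ^ 2) : ℝ) : ℂ) := by
      rw [← Complex.ofReal_mul, key]; push_cast; ring
    change (g v : ℂ) * (e v * (Complex.I * ((S * ψ' v : ℝ) : ℂ))) = (-Complex.I * S * l) * (e v * ((1 / (1 + v ^ 2) : ℝ) : ℂ))
    rw [Complex.ofReal_mul S]
    linear_combination (e v * Complex.I * S) * key'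
  have hb1 : ‖∫ v in δ..M, (g' v : ℂ) * e v‖ ≤ ∫ v in δ..M, ((1 + 1 / c) + (v ^ 2)⁻¹) := by
    apply intervalIntegral.norm_integral_le_of_norm_le hδM
    · filter_upwards with v hv
      have hv0 : 0 < v := hδ.trans hv.1
      rw [norm_mul, hen, mul_one, Complex.norm_real, Real.norm_eq_abs]
      simp only [hg']
      have a1 : |(1 + -(v ^ 2)⁻¹) * ψ v| ≤ 1 + (v ^ 2)⁻¹ := by
        rw [abs_mul, abs_of_pos (hψ0 v)]
        have h3 : |1 + -(v ^ 2)⁻¹| ≤ 1 + (v ^ 2)⁻¹ := by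
          have : 0 < (v ^ 2)⁻¹ := by positivity
          rw [abs_le]; constructor <;> linarith
        calc _ ≤ (1 + (v ^ 2)⁻¹) * 1 := by gcongr; exact hψ1 v
          _ = _ := by ring
      have a2 : |(v + v⁻¹) * ψ' v| ≤ 1 / c := by
        have : (v + v⁻¹) * ψ' v = -(l / ((1 + v ^ 2) * ψ v)) := by
          simp only [hψ']
          have := (hψ0 v).ne'
          field_simp
          ring
        rw [this, abs_neg, abs_of_pos (by have := hψ0 v; positivity)]
        apply div_le_div₀ zero_le_one hl1 hc
        nlinarith [hψc v, sq_nonneg v, hψ0 v, mul_nonneg (sq_nonneg v) (hψ0 v).le]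
      exact (abs_add_le _ _).trans (by linarith)
    · apply ContinuousOn.intervalIntegrable
      apply ContinuousOn.add continuousOn_const
      apply ContinuousOn.inv₀ (by fun_prop); intro v hv; have := hsub v hv; positivity
  have hIntg : ∫ v in δ..M, ((1 + 1 / c) + (v ^ 2)⁻¹) = ((1 + 1 / c) * M - M⁻¹) - ((1 + 1 / c) * δ - δ⁻¹) := by
    apply intervalIntegral.integral_eq_sub_of_hasDerivAt (f := fun v => (1 + 1 / c) * v - v⁻¹)
    · intro v hv
      have := ((hasDerivAt_id v).const_mul (1 + 1 / c)).sub (hasDerivAt_inv (hsub v hv).ne')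
      have h2 : (1 + 1 / c) * 1 - -(v ^ 2)⁻¹ = 1 + 1 / c + (v ^ 2)⁻¹ := by ring
      rw [h2] at this
      exact this
    · apply ContinuousOn.intervalIntegrable
      apply ContinuousOn.add continuousOn_const
      apply ContinuousOn.inv₀ (by fun_prop); intro v hv; have := hsub v hv; positivity
  rw [hIntg] at hb1
  have hM0 : 0 < M := hδ.trans_le hδM
  have hMi : M⁻¹ ≤ δ⁻¹ := inv_anti₀ hδ hδM
  have hMi0 : 0 < M⁻¹ := by positivity
  rw [one_div] at hM hδ1
  have hδi : 0 < δ⁻¹ := by positivity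
  have hci : 1 ≤ 1 / c := by rw [le_div_iff₀ hc]; linarith
  have hgM : ‖(g M : ℂ) * e M‖ ≤ 2 * δ⁻¹ := by
    rw [norm_mul, hen, mul_one, Complex.norm_real, Real.norm_eq_abs, abs_of_pos (by have := hψ0 M; positivity)]
    simp only [hg]; nlinarith [hψ1 M, hψ0 M]
  have hgδ : ‖(g δ : ℂ) * e δ‖ ≤ 2 * δ⁻¹ := by
    rw [norm_mul, hen, mul_one, Complex.norm_real, Real.norm_eq_abs, abs_of_pos (by have := hψ0 δ; positivity)]
    simp only [hg]; nlinarith [hψ1 δ, hψ0 δ]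
  have htot : ‖(-Complex.I * S * l) * ∫ v in δ..M, e v * ((1 / (1 + v ^ 2) : ℝ) : ℂ)‖ ≤ 7 * (1 / c) * δ⁻¹ := by
    rw [← hL, ibp]
    calc _ ≤ ‖(g M : ℂ) * e M‖ + ‖(g δ : ℂ) * e δ‖ + ‖∫ v in δ..M, (g' v : ℂ) * e v‖ := 
          (norm_sub_le _ _).trans (by gcongr; exact norm_sub_le _ _)
      _ ≤ 2 * δ⁻¹ + 2 * δ⁻¹ + (((1 + 1 / c) * M - M⁻¹) - ((1 + 1 / c) * δ - δ⁻¹)) := by gcongr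
      _ ≤ _ := by nlinarith
  rw [norm_mul] at htot
  have hn : ‖(-Complex.I * S * l)‖ = |S| * l := by
    simp [abs_of_pos hl]
  rw [hn] at htot
  have hS0 : 0 < |S| := abs_pos.2 hS
  change ‖∫ v in δ..M, e v * ((1 / (1 + v ^ 2) : ℝ) : ℂ)‖ ≤ _
  rw [show 7 * (1 / (c * |S| * l)) / δ = (7 * (1 / c) * δ⁻¹) / (|S| * l) by field_simp, le_div_iff₀ (by positivity)]
  linarith

lemma osc_triv {a b : ℝ} (hab : a ≤ b) (φ : ℝ → ℝ) :
    ‖∫ v in a..b, Complex.exp (Complex.I * ((φ v : ℝ) : ℂ)) *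
      ((1 / (1 + v ^ 2) : ℝ) : ℂ)‖ ≤ Real.arctan b - Real.arctan a := by
  rw [← integral_one_div_one_add_sq]
  apply intervalIntegral.norm_integral_le_of_norm_le hab
  · filter_upwards with v hv
    rw [norm_mul, mul_comm I, Complex.norm_exp_ofReal_mul_I, one_mul, Complex.norm_real, Real.norm_eq_abs,
      abs_of_pos (by positivity)]
  · apply Continuous.intervalIntegrable
    exact Continuous.div continuous_const (by fun_prop) (fun v => by positivity)

lemma osc_half {c l S K : ℝ} (hc : 0 < c) (hl : 0 < l) (hcl : c ^ 2 + l ≤ 1) (hS : S ≠ 0)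
    (hK : 0 ≤ K) :
    ‖∫ v in (0:ℝ)..K, Complex.exp (Complex.I * ((S * Real.sqrt (c ^ 2 + l / (1 + v ^ 2)) : ℝ) : ℂ)) *
      ((1 / (1 + v ^ 2) : ℝ) : ℂ)‖ ≤ 9 * (1 / (c * |S| * l)) ^ (1 / 3 : ℝ) := by
  have hS0 : 0 < |S| := abs_pos.2 hS
  set D := 1 / (c * |S| * l) with hD
  have hD0 : 0 < D := by positivity
  set δ := D ^ (1 / 3 : ℝ) with hδ
  have hδ0 : 0 < δ := by positivity
  have hδ3 : D = δ ^ 3 := by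
    rw [hδ, ← Real.rpow_natCast, ← Real.rpow_mul hD0.le]; norm_num
  have hatle : ∀ x : ℝ, 0 ≤ x → Real.arctan x ≤ x := fun x hx => by
    
    have := Real.le_tan (Real.arctan_nonneg.2 hx) (Real.arctan_lt_pi_div_two x)
    rwa [Real.tan_arctan] at this
  have htr := osc_triv hK (fun v => S * Real.sqrt (c ^ 2 + l / (1 + v ^ 2)))
  rw [Real.arctan_zero, sub_zero] at htr
  rcases le_or_gt K δ with h | hKδ
  · linarith [hatle K hK]
  rcases le_or_gt 1 δ with h1 | hδ1
  · have := Real.arctan_lt_pi_div_two K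
    linarith [Real.pi_le_four]
  have hδδ : δ ≤ 1 / δ := by rw [le_div_iff₀ hδ0]; nlinarith
  set M := min K (1 / δ) with hM
  have hδM : δ ≤ M := le_min hKδ.le hδδ
  have hMK : M ≤ K := min_le_left _ _
  set f : ℝ → ℂ := fun v => Complex.exp (Complex.I * ((S * Real.sqrt (c ^ 2 + l / (1 + v ^ 2)) : ℝ) : ℂ)) *
      ((1 / (1 + v ^ 2) : ℝ) : ℂ) with hf
  have hfc : Continuous f := by
    have : Continuous fun v : ℝ => l / (1 + v ^ 2) := 
      Continuous.div continuous_const (by fun_prop) (fun v => by positivity)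
    have : Continuous fun v : ℝ => 1 / (1 + v ^ 2) := 
      Continuous.div continuous_const (by fun_prop) (fun v => by positivity)
    fun_prop
  have hsplit : ∫ v in (0:ℝ)..K, f v = (∫ v in (0:ℝ)..δ, f v) + (∫ v in δ..M, f v) + ∫ v in M..K, f v := by
    rw [intervalIntegral.integral_add_adjacent_intervals, intervalIntegral.integral_add_adjacent_intervals] <;>
    exact hfc.intervalIntegrable _ _
  have i1 := osc_triv hδ0.le (fun v => S * Real.sqrt (c ^ 2 + l / (1 + v ^ 2)))
  have i2 := osc_mid hc hl hcl hS hδ0 hδM (min_le_right _ _)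
  have i3 := osc_triv hMK (fun v => S * Real.sqrt (c ^ 2 + l / (1 + v ^ 2)))
  have j1 : Real.arctan δ - Real.arctan 0 ≤ δ := by rw [Real.arctan_zero, sub_zero]; exact hatle _ hδ0.le
  have j3 : Real.arctan K - Real.arctan M ≤ δ := by
    rcases le_total K (1 / δ) with h | h
    · rw [hM, min_eq_left h]; linarith
    · rw [hM, min_eq_right h, one_div, Real.arctan_inv_of_pos hδ0]
      have := Real.arctan_lt_pi_div_two K
      linarith [hatle δ hδ0.le]
  have j2 : 7 * (1 / (c * |S| * l)) / δ ≤ 7 * δ := by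
    rw [← hD, hδ3, div_le_iff₀ hδ0]; nlinarith [sq_nonneg δ, mul_pos hδ0 hδ0]
  rw [hsplit]
  calc _ ≤ _ := norm_add₃_le
    _ ≤ δ + 7 * δ + δ := by gcongr <;> linarith
    _ = _ := by ring

end Osc


lemma osc_full {c m S r σ K : ℝ} (hc : 0 < c) (hm : 0 < m) (hcm : c ^ 2 + m ≤ 1) (hS : S ≠ 0)
    (hr : 0 < r) (hσ : σ ≠ 0) (hK : 0 ≤ K) :
    ‖∫ κ in (-K)..K, Complex.exp (Complex.I *
        ((S * Real.sqrt (c ^ 2 + m * r ^ 2 / (r ^ 2 + σ ^ 2 + κ ^ 2)) : ℝ) : ℂ)) *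
      ((1 / (r ^ 2 + σ ^ 2 + κ ^ 2) : ℝ) : ℂ)‖
      ≤ 18 * (1 / (c * |S| * m)) ^ (1 / 3 : ℝ) * (|σ| ^ (-(1 / 3) : ℝ) * r ^ (-(2 / 3) : ℝ)) := by
  have hS0 : 0 < |S| := abs_pos.2 hS
  have hσ0 : 0 < |σ| := abs_pos.2 hσ
  set B := Real.sqrt (r ^ 2 + σ ^ 2) with hB
  have hB0 : 0 < B := by positivity
  have hB2 : B ^ 2 = r ^ 2 + σ ^ 2 := Real.sq_sqrt (by positivity)
  have hσB : |σ| ≤ B := by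
    rw [hB]; apply Real.le_sqrt_of_sq_le; rw [sq_abs]; nlinarith
  have hrB : r ^ 2 ≤ B ^ 2 := by rw [hB2]; nlinarith [sq_nonneg σ]
  set f : ℝ → ℂ := fun κ => Complex.exp (Complex.I *
        ((S * Real.sqrt (c ^ 2 + m * r ^ 2 / (r ^ 2 + σ ^ 2 + κ ^ 2)) : ℝ) : ℂ)) *
      ((1 / (r ^ 2 + σ ^ 2 + κ ^ 2) : ℝ) : ℂ) with hf
  have hfc : Continuous f := by
    have : Continuous fun v : ℝ => m * r ^ 2 / (r ^ 2 + σ ^ 2 + v ^ 2) := 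
      Continuous.div continuous_const (by fun_prop) (fun v => by positivity)
    have : Continuous fun v : ℝ => 1 / (r ^ 2 + σ ^ 2 + v ^ 2) := 
      Continuous.div continuous_const (by fun_prop) (fun v => by positivity)
    fun_prop
  have heven : ∫ κ in (-K)..K, f κ = 2 * ∫ κ in (0:ℝ)..K, f κ := by
    rw [← intervalIntegral.integral_add_adjacent_intervals (b := 0) (hfc.intervalIntegrable _ _) (hfc.intervalIntegrable _ _)]
    have : ∫ κ in (-K)..0, f κ = ∫ κ in (0:ℝ)..K, f κ := by
      have h := intervalIntegral.integral_comp_neg (a := 0) (b := K) f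
      rw [neg_zero] at h
      rw [← h]
      apply intervalIntegral.integral_congr
      intro κ _
      simp [hf]
    rw [this]; ring
  set l := m * (r ^ 2 / B ^ 2) with hl
  have hl0 : 0 < l := by positivity
  have hlm : l ≤ m := by
    rw [hl]; apply mul_le_of_le_one_right hm.le; rw [div_le_one (by positivity)]; exact hrB
  have hsub : ∫ κ in (0:ℝ)..K, f κ = (B⁻¹ : ℂ) * ∫ v in (0:ℝ)..(K / B), Complex.exp (Complex.I * ((S * Real.sqrt (c ^ 2 + l / (1 + v ^ 2)) : ℝ) : ℂ)) *
      ((1 / (1 + v ^ 2) : ℝ) : ℂ) := by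
    have h := intervalIntegral.smul_integral_comp_mul_left (a := 0) (b := K / B) f B
    rw [mul_zero, mul_div_cancel₀ _ hB0.ne'] at h
    rw [← h, Complex.real_smul, ← intervalIntegral.integral_const_mul, ← intervalIntegral.integral_const_mul]
    apply intervalIntegral.integral_congr
    intro v _
    have e1 : m * r ^ 2 / (r ^ 2 + σ ^ 2 + (B * v) ^ 2) = l / (1 + v ^ 2) := by
      rw [← hB2, hl]; field_simp
    have e2 : (1 / (r ^ 2 + σ ^ 2 + (B * v) ^ 2)) = B⁻¹ * (B⁻¹ * (1 / (1 + v ^ 2))) := by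
      rw [← hB2]; field_simp
    simp only [hf]
    rw [e1, e2]
    have : (B : ℂ) ≠ 0 := by exact_mod_cast hB0.ne'
    push_cast
    field_simp
  have hh := osc_half hc hl0 (by linarith) hS (K := K / B) (by positivity)
  have key : (1 / (c * |S| * l)) ^ (1 / 3 : ℝ) * B⁻¹ ≤ (1 / (c * |S| * m)) ^ (1 / 3 : ℝ) * (|σ| ^ (-(1 / 3) : ℝ) * r ^ (-(2 / 3) : ℝ)) := by
    have e1 : 1 / (c * |S| * l) = 1 / (c * |S| * m) * (B ^ 2 * (r ^ 2)⁻¹) := by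
      rw [hl]; field_simp
    rw [e1, Real.mul_rpow (by positivity) (by positivity), mul_assoc]
    apply mul_le_mul_of_nonneg_left _ (by positivity)
    rw [Real.mul_rpow (by positivity) (by positivity), Real.inv_rpow (by positivity), ← Real.rpow_natCast, ← Real.rpow_natCast,
      ← Real.rpow_mul hB0.le, ← Real.rpow_mul hr.le, ← Real.rpow_neg hr.le]
    rw [show (B ^ (((2:ℕ):ℝ) * (1/3)) * r ^ (-(((2:ℕ):ℝ) * (1/3))) * B⁻¹) = (B ^ (((2:ℕ):ℝ) * (1/3)) * B⁻¹) * r ^ (-(((2:ℕ):ℝ) * (1/3))) by ring]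
    rw [← Real.rpow_neg_one B, ← Real.rpow_add hB0]
    norm_num
    apply mul_le_mul_of_nonneg_right _ (by positivity)
    exact Real.rpow_le_rpow_of_nonpos hσ0 hσB (by norm_num)
  rw [heven, hsub, norm_mul, norm_mul]
  have : ‖(B⁻¹ : ℂ)‖ = B⁻¹ := by rw [norm_inv, Complex.norm_real, Real.norm_of_nonneg hB0.le]
  rw [this, Complex.norm_ofNat]
  calc _ ≤ 2 * (B⁻¹ * (9 * (1 / (c * |S| * l)) ^ (1 / 3 : ℝ))) := by gcongr
    _ = 18 * ((1 / (c * |S| * l)) ^ (1 / 3 : ℝ) * B⁻¹) := by ring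
    _ ≤ 18 * ((1 / (c * |S| * m)) ^ (1 / 3 : ℝ) * (|σ| ^ (-(1 / 3) : ℝ) * r ^ (-(2 / 3) : ℝ))) := by gcongr
    _ = _ := by ring


section HLSsec
open Set

/-- Bilinear Hardy-Littlewood-Sobolev bound with exponents `6/5`. -/
def HLS {X : Type*} [MeasurableSpace X] (μ : Measure X) (k : X → X → ℝ≥0∞) (C : ℝ≥0∞) : Prop :=
  ∀ f g : X → ℝ≥0∞, Measurable f → Measurable g →
    ∫⁻ x, ∫⁻ y, f x * g y * k x y ∂μ ∂μ
      ≤ C * (∫⁻ x, f x ^ (6 / 5 : ℝ) ∂μ) ^ (5 / 6 : ℝ) * (∫⁻ x, g x ^ (6 / 5 : ℝ) ∂μ) ^ (5 / 6 : ℝ)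

/-- one-dimensional kernel -/
def k1 (x y : ℝ) : ℝ≥0∞ := ENNReal.ofReal (|x - y| ^ (-(1 / 3) : ℝ))

lemma measurable_k1 : Measurable (fun p : ℝ × ℝ => k1 p.1 p.2) := by
  unfold k1; fun_prop

lemma lint_abs {h : ℝ → ℝ≥0∞} : 
    ∫⁻ u : ℝ, h |u| = 2 * ∫⁻ u in Ioi (0:ℝ), h u := by
  have e1 : ∫⁻ u in Ioi (0:ℝ), h |u| = ∫⁻ u in Ioi (0:ℝ), h u := 
    setLIntegral_congr_fun measurableSet_Ioi (fun u hu => by rw [abs_of_pos hu])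
  have e2 : ∫⁻ u in Iio (0:ℝ), h |u| = ∫⁻ u in Ioi (0:ℝ), h |u| := by
    have mp := (Measure.measurePreserving_neg (volume : Measure ℝ))
    have := mp.setLIntegral_comp_emb (MeasurableEquiv.neg ℝ).measurableEmbedding (fun u => h |u|) (Iio 0)
    rw [image_neg_Iio, neg_zero] at this
    simp only [abs_neg] at this; exact this
  rw [← lintegral_add_compl _ (measurableSet_Ioi (a := (0:ℝ))), compl_Ioi,
    setLIntegral_congr (Iio_ae_eq_Iic (a := (0:ℝ))).symm, e2, e1, two_mul]

lemma hls_near {R : ℝ} (hR : 0 < R) (x : ℝ) :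
    ∫⁻ y, (if |x - y| ≤ R then k1 x y else 0) ≤ ENNReal.ofReal (3 * R ^ (2 / 3 : ℝ)) := by
  unfold k1
  rw [lintegral_sub_left_eq_self (fun u => if |u| ≤ R then ENNReal.ofReal (|u| ^ (-(1 / 3) : ℝ)) else 0) x]
  rw [lint_abs (h := fun u => if u ≤ R then ENNReal.ofReal (u ^ (-(1 / 3) : ℝ)) else 0)]
  have : ∫⁻ u in Ioi (0:ℝ), (if u ≤ R then ENNReal.ofReal (u ^ (-(1 / 3) : ℝ)) else 0)
      = ∫⁻ u in Ioc (0:ℝ) R, ENNReal.ofReal (u ^ (-(1 / 3) : ℝ)) := by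
    rw [← lintegral_indicator measurableSet_Ioi, ← lintegral_indicator measurableSet_Ioc]
    congr 1; ext u
    simp only [indicator, mem_Ioi, mem_Ioc]
    split_ifs <;> simp_all
  rw [this, ← ofReal_integral_eq_lintegral_ofReal, ← intervalIntegral.integral_of_le hR.le, integral_rpow (Or.inl (by norm_num)),
    Real.zero_rpow (by norm_num), show (2:ℝ≥0∞) = ENNReal.ofReal 2 by simp, ← ENNReal.ofReal_mul (by norm_num)]
  · apply ENNReal.ofReal_le_ofReal
    norm_num
    linarith
  · have := intervalIntegral.intervalIntegrable_rpow' (a := 0) (b := R) (r := -(1/3)) (by norm_num)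
    rwa [intervalIntegrable_iff_integrableOn_Ioc_of_le hR.le] at this
  · filter_upwards [ae_restrict_mem measurableSet_Ioc] with u hu
    exact Real.rpow_nonneg hu.1.le _

lemma hls_far {R : ℝ} (hR : 0 < R) (x : ℝ) :
    ∫⁻ y, (if |x - y| ≤ R then 0 else k1 x y) ^ (6:ℝ) ≤ ENNReal.ofReal (2 / R) := by
  unfold k1
  rw [lintegral_sub_left_eq_self (fun u => (if |u| ≤ R then 0 else ENNReal.ofReal (|u| ^ (-(1 / 3) : ℝ))) ^ (6:ℝ)) x]
  rw [lint_abs (h := fun u => (if u ≤ R then 0 else ENNReal.ofReal (u ^ (-(1 / 3) : ℝ))) ^ (6:ℝ))]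
  have : ∫⁻ u in Ioi (0:ℝ), (if u ≤ R then 0 else ENNReal.ofReal (u ^ (-(1 / 3) : ℝ))) ^ (6:ℝ)
      = ∫⁻ u in Ioi R, ENNReal.ofReal (u ^ (-2 : ℝ)) := by
    rw [← lintegral_indicator measurableSet_Ioi, ← lintegral_indicator measurableSet_Ioi]
    congr 1; ext u
    simp only [indicator, mem_Ioi]
    split_ifs with h1 h2 h3 h4
    · linarith
    · simp
    · rw [ENNReal.ofReal_rpow_of_nonneg (by positivity) (by norm_num), ← Real.rpow_mul h1.le]; norm_num
    · linarith
    · linarith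
    · rfl
  rw [this, ← ofReal_integral_eq_lintegral_ofReal, integral_Ioi_rpow_of_lt (by norm_num) hR,
    show (2:ℝ≥0∞) = ENNReal.ofReal 2 by simp, ← ENNReal.ofReal_mul (by norm_num)]
  · apply ENNReal.ofReal_le_ofReal
    norm_num
    rw [Real.rpow_neg_one]
    exact le_of_eq (by ring)
  · exact integrableOn_Ioi_rpow_of_lt (by norm_num) hR
  · filter_upwards [ae_restrict_mem measurableSet_Ioi] with u hu
    exact Real.rpow_nonneg (hR.le.trans (le_of_lt hu)) _

lemma hls_inner {g : ℝ → ℝ≥0∞} (hg : Measurable g) (hg1 : ∫⁻ x, g x ^ (6 / 5 : ℝ) ≤ 1)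
    (a : ℝ≥0∞) (x : ℝ) (ha : a ≠ ∞) :
    a * ∫⁻ y, (if g y ≤ a then g y * k1 x y else 0) ≤ 5 * a ^ (6 / 5 : ℝ) := by
  rcases eq_or_ne a 0 with rfl | ha0
  · simp
  have hk : Measurable (k1 x) := measurable_k1.comp measurable_prodMk_left
  set b := a.toReal with hb
  have hb0 : 0 < b := ENNReal.toReal_pos ha0 ha
  have hab : a = ENNReal.ofReal b := (ENNReal.ofReal_toReal ha).symm
  set R := b ^ (-(6 / 5) : ℝ) with hR
  have hR0 : 0 < R := by positivity
  have hset : MeasurableSet {y : ℝ | |x - y| ≤ R} := measurableSet_le (by fun_prop) (by fun_prop)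
  have step : ∫⁻ y, (if g y ≤ a then g y * k1 x y else 0)
      ≤ (a * ∫⁻ y, (if |x - y| ≤ R then k1 x y else 0)) + ∫⁻ y, g y * (if |x - y| ≤ R then 0 else k1 x y) := by
    rw [← lintegral_const_mul _ (Measurable.ite hset hk measurable_const), ← lintegral_add_left]
    · apply lintegral_mono
      intro y
      simp only
      split_ifs with h1 h2
      · rw [mul_zero, add_zero]; gcongr
      · simp
      · simp
      · simp
    · exact (Measurable.ite hset hk measurable_const).const_mul _
  have hn : a * ∫⁻ y, (if |x - y| ≤ R then k1 x y else 0) ≤ ENNReal.ofReal (3 * b ^ (1 / 5 : ℝ)) := by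
    calc _ ≤ ENNReal.ofReal b * ENNReal.ofReal (3 * R ^ (2 / 3 : ℝ)) := by
          rw [← hab]; gcongr; exact hls_near hR0 x
      _ = _ := by
        rw [← ENNReal.ofReal_mul hb0.le]
        congr 1
        rw [hR, ← Real.rpow_mul hb0.le, show b * (3 * b ^ (-(6 / 5) * (2 / 3) : ℝ)) = 3 * (b ^ (1:ℝ) * b ^ (-(6 / 5) * (2 / 3) : ℝ)) by
          rw [Real.rpow_one]; ring, ← Real.rpow_add hb0]
        norm_num
  have hf : ∫⁻ y, g y * (if |x - y| ≤ R then 0 else k1 x y) ≤ ENNReal.ofReal (2 * b ^ (1 / 5 : ℝ)) := by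
    have hol := ENNReal.lintegral_mul_le_Lp_mul_Lq (volume : Measure ℝ) (p := 6 / 5) (q := 6)
      (Real.holderConjugate_iff.2 ⟨by norm_num, by norm_num⟩) hg.aemeasurable
      (g := fun y => if |x - y| ≤ R then 0 else k1 x y) (Measurable.ite hset measurable_const hk).aemeasurable
    refine hol.trans ?_
    calc _ ≤ (1:ℝ≥0∞) ^ (1 / (6 / 5) : ℝ) * (ENNReal.ofReal (2 / R)) ^ (1 / 6 : ℝ) := by
          gcongr
          exact hls_far hR0 x
      _ ≤ _ := by
        rw [ENNReal.one_rpow, one_mul, ENNReal.ofReal_rpow_of_nonneg (by positivity) (by norm_num)]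
        apply ENNReal.ofReal_le_ofReal
        rw [Real.div_rpow (by norm_num) hR0.le, hR, ← Real.rpow_mul hb0.le]
        rw [div_eq_mul_inv, ← Real.rpow_neg hb0.le]
        norm_num
        gcongr
        calc (2:ℝ) ^ (1 / 6 : ℝ) ≤ 2 ^ (1:ℝ) := Real.rpow_le_rpow_of_exponent_le (by norm_num) (by norm_num)
          _ = 2 := by norm_num
  calc _ ≤ a * (ENNReal.ofReal (3 * b ^ (1 / 5 : ℝ)) + ENNReal.ofReal (2 * b ^ (1 / 5 : ℝ))) := by
        gcongr; exact step.trans (add_le_add hn hf)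
    _ = _ := by
      rw [← ENNReal.ofReal_add (by positivity) (by positivity), hab, ← ENNReal.ofReal_mul hb0.le,
        ENNReal.ofReal_rpow_of_nonneg hb0.le (by norm_num), show (5:ℝ≥0∞) = ENNReal.ofReal 5 by simp, ← ENNReal.ofReal_mul (by norm_num)]
      congr 1
      rw [show (6/5:ℝ) = 1 + 1/5 by norm_num, Real.rpow_add hb0, Real.rpow_one]; ring

lemma hls_core {f g : ℝ → ℝ≥0∞} (hf : Measurable f) (hg : Measurable g)
    (hf1 : ∫⁻ x, f x ^ (6 / 5 : ℝ) ≤ 1) (hg1 : ∫⁻ x, g x ^ (6 / 5 : ℝ) ≤ 1) :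
    ∫⁻ x, ∫⁻ y, (if g y ≤ f x then f x * g y * k1 x y else 0) ≤ 5 := by
  have hfin : ∀ᵐ x, f x ≠ ∞ := by
    have := ae_lt_top (hf.pow_const (6/5:ℝ)) (ne_top_of_le_ne_top ENNReal.one_ne_top hf1)
    filter_upwards [this] with x hx h
    rw [h, ENNReal.top_rpow_of_pos (by norm_num)] at hx
    exact lt_irrefl _ hx
  calc _ ≤ ∫⁻ x, 5 * f x ^ (6 / 5 : ℝ) := by
        apply lintegral_mono_ae
        filter_upwards [hfin] with x hx
        refine le_trans (le_of_eq ?_) (hls_inner hg hg1 (f x) x hx)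
        rw [← lintegral_const_mul' _ _ hx]
        congr 1; ext y; split_ifs <;> simp [mul_assoc]
    _ = 5 * ∫⁻ x, f x ^ (6 / 5 : ℝ) := lintegral_const_mul _ (by fun_prop)
    _ ≤ 5 * 1 := by gcongr
    _ = 5 := mul_one _

lemma k1_symm (x y : ℝ) : k1 x y = k1 y x := by unfold k1; rw [abs_sub_comm]

lemma hls_norm {f g : ℝ → ℝ≥0∞} (hf : Measurable f) (hg : Measurable g)
    (hf1 : ∫⁻ x, f x ^ (6 / 5 : ℝ) ≤ 1) (hg1 : ∫⁻ x, g x ^ (6 / 5 : ℝ) ≤ 1) :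
    ∫⁻ x, ∫⁻ y, f x * g y * k1 x y ≤ 10 := by
  have hk := measurable_k1
  have m1 : Measurable fun p : ℝ × ℝ => (if g p.2 ≤ f p.1 then f p.1 * g p.2 * k1 p.1 p.2 else 0) := 
    Measurable.ite (measurableSet_le (by fun_prop) (by fun_prop)) (by fun_prop) measurable_const
  have m2 : Measurable fun p : ℝ × ℝ => (if f p.1 ≤ g p.2 then f p.1 * g p.2 * k1 p.1 p.2 else 0) := 
    Measurable.ite (measurableSet_le (by fun_prop) (by fun_prop)) (by fun_prop) measurable_const
  calc _ ≤ ∫⁻ x, ∫⁻ y, ((if g y ≤ f x then f x * g y * k1 x y else 0) + 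
            (if f x ≤ g y then f x * g y * k1 x y else 0)) := by
        apply lintegral_mono; intro x; apply lintegral_mono; intro y
        rcases le_total (g y) (f x) with h | h <;> simp [h]
    _ = (∫⁻ x, ∫⁻ y, (if g y ≤ f x then f x * g y * k1 x y else 0)) + 
          ∫⁻ x, ∫⁻ y, (if f x ≤ g y then f x * g y * k1 x y else 0) := by
        rw [← lintegral_add_left]
        · congr 1; ext x
          rw [lintegral_add_left]
          exact m1.comp measurable_prodMk_left
        · exact m1.lintegral_prod_right'
    _ ≤ 5 + 5 := by
        gcongr
        · exact hls_core hf hg hf1 hg1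
        · rw [lintegral_lintegral_swap m2.aemeasurable]
          refine le_trans (le_of_eq ?_) (hls_core hg hf hg1 hf1)
          congr 1; ext y; congr 1; ext x
          rw [k1_symm x y, mul_comm (f x)]
    _ = 10 := by norm_num

lemma hls_one : HLS (volume : Measure ℝ) k1 10 := by
  intro f g hf hg
  set A := ∫⁻ x, f x ^ (6 / 5 : ℝ) with hA
  set B := ∫⁻ x, g x ^ (6 / 5 : ℝ) with hB
  have hz : ∀ h : ℝ → ℝ≥0∞, Measurable h → ∫⁻ x, h x ^ (6 / 5 : ℝ) = 0 → ∀ᵐ x, h x = 0 := by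
    intro h hh h0
    rw [lintegral_eq_zero_iff (by fun_prop)] at h0
    filter_upwards [h0] with x hx
    rw [Pi.zero_apply, ENNReal.rpow_eq_zero_iff] at hx
    rcases hx with h | ⟨_, h⟩
    · exact h.1
    · norm_num at h
  rcases eq_or_ne A 0 with hA0 | hA0
  · refine le_trans (le_of_eq ?_) (zero_le)
    rw [lintegral_congr_ae (g := fun _ => 0)]
    · simp
    filter_upwards [hz f hf hA0] with x hx
    simp [hx]
  rcases eq_or_ne B 0 with hB0 | hB0
  · refine le_trans (le_of_eq ?_) (zero_le)
    rw [lintegral_congr_ae (g := fun _ => 0)]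
    · simp
    filter_upwards with x
    rw [lintegral_congr_ae (g := fun _ => 0)]
    · simp
    filter_upwards [hz g hg hB0] with y hy
    simp [hy]
  have hA0' : A ^ (5 / 6 : ℝ) ≠ 0 := by
    rw [Ne, ENNReal.rpow_eq_zero_iff]; norm_num [hA0]
  have hB0' : B ^ (5 / 6 : ℝ) ≠ 0 := by
    rw [Ne, ENNReal.rpow_eq_zero_iff]; norm_num [hB0]
  rcases eq_or_ne A ∞ with hAt | hAt
  · rw [hAt, ENNReal.top_rpow_of_pos (by norm_num), ENNReal.mul_top (by norm_num), ENNReal.top_mul hB0']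
    exact le_top
  rcases eq_or_ne B ∞ with hBt | hBt
  · rw [hBt, ENNReal.top_rpow_of_pos (by norm_num), ENNReal.mul_top (mul_ne_zero (by norm_num) hA0')]
    exact le_top
  have hAt' : A ^ (5 / 6 : ℝ) ≠ ∞ := by simp [ENNReal.rpow_eq_top_iff, hAt, hA0]
  have hBt' : B ^ (5 / 6 : ℝ) ≠ ∞ := by simp [ENNReal.rpow_eq_top_iff, hBt, hB0]
  have hnorm : ∀ (h : ℝ → ℝ≥0∞) (D : ℝ≥0∞), Measurable h → ∫⁻ x, h x ^ (6 / 5 : ℝ) = D → D ≠ 0 → D ≠ ∞ →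
      ∫⁻ x, ((D ^ (5 / 6 : ℝ))⁻¹ * h x) ^ (6 / 5 : ℝ) ≤ 1 := by
    intro h D hh hD h0 ht
    simp_rw [ENNReal.mul_rpow_of_nonneg _ _ (by norm_num : (0:ℝ) ≤ 6 / 5)]
    rw [lintegral_const_mul _ (by fun_prop), hD, ENNReal.inv_rpow, ← ENNReal.rpow_mul]
    norm_num [ENNReal.inv_mul_cancel h0 ht]
  have := hls_norm (hf.const_mul (A ^ (5 / 6 : ℝ))⁻¹) (hg.const_mul (B ^ (5 / 6 : ℝ))⁻¹)
    (hnorm f A hf hA.symm hA0 hAt) (hnorm g B hg hB.symm hB0 hBt)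
  have e : ∫⁻ x, ∫⁻ y, ((A ^ (5 / 6 : ℝ))⁻¹ * f x) * ((B ^ (5 / 6 : ℝ))⁻¹ * g y) * k1 x y
      = ((A ^ (5 / 6 : ℝ))⁻¹ * (B ^ (5 / 6 : ℝ))⁻¹) * ∫⁻ x, ∫⁻ y, f x * g y * k1 x y := by
    have hc : ((A ^ (5 / 6 : ℝ))⁻¹ * (B ^ (5 / 6 : ℝ))⁻¹) ≠ ∞ := ENNReal.mul_ne_top (by simpa using hA0') (by simpa using hB0')
    rw [← lintegral_const_mul' _ _ hc]
    congr 1; ext x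
    rw [← lintegral_const_mul' _ _ hc]
    congr 1; ext y; ring
  rw [e] at this
  calc _ = (A ^ (5 / 6 : ℝ) * B ^ (5 / 6 : ℝ)) * (((A ^ (5 / 6 : ℝ))⁻¹ * (B ^ (5 / 6 : ℝ))⁻¹) * ∫⁻ x, ∫⁻ y, f x * g y * k1 x y) := by
        rw [← mul_assoc, show (A ^ (5 / 6 : ℝ) * B ^ (5 / 6 : ℝ)) * ((A ^ (5 / 6 : ℝ))⁻¹ * (B ^ (5 / 6 : ℝ))⁻¹)
          = (A ^ (5 / 6 : ℝ) * (A ^ (5 / 6 : ℝ))⁻¹) * (B ^ (5 / 6 : ℝ) * (B ^ (5 / 6 : ℝ))⁻¹) by ring,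
          ENNReal.mul_inv_cancel hA0' hAt', ENNReal.mul_inv_cancel hB0' hBt', one_mul, one_mul]
    _ ≤ (A ^ (5 / 6 : ℝ) * B ^ (5 / 6 : ℝ)) * 10 := by gcongr
    _ = _ := by ring

lemma HLS.prod {X Y : Type*} [MeasurableSpace X] [MeasurableSpace Y] {μ : Measure X} {ν : Measure Y}
    [SFinite μ] [SFinite ν] {k : X → X → ℝ≥0∞} {l : Y → Y → ℝ≥0∞} {C D : ℝ≥0∞}
    (hk : Measurable fun p : X × X => k p.1 p.2) (hl : Measurable fun p : Y × Y => l p.1 p.2)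
    (h1 : HLS μ k C) (h2 : HLS ν l D) :
    HLS (μ.prod ν) (fun p q => k p.1 q.1 * l p.2 q.2) (C * D) := by
  intro f g hf hg
  set F : X → ℝ≥0∞ := fun x => (∫⁻ y, f (x, y) ^ (6 / 5 : ℝ) ∂ν) ^ (5 / 6 : ℝ) with hF
  set G : X → ℝ≥0∞ := fun x => (∫⁻ y, g (x, y) ^ (6 / 5 : ℝ) ∂ν) ^ (5 / 6 : ℝ) with hG
  have mF : Measurable F := (Measurable.lintegral_prod_right' (f := fun p => f p ^ (6 / 5 : ℝ)) (by fun_prop)).pow_const _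
  have mG : Measurable G := (Measurable.lintegral_prod_right' (f := fun p => g p ^ (6 / 5 : ℝ)) (by fun_prop)).pow_const _
  have eF : ∀ h : X × Y → ℝ≥0∞, Measurable h → 
      ∫⁻ x, ((∫⁻ y, h (x, y) ^ (6 / 5 : ℝ) ∂ν) ^ (5 / 6 : ℝ)) ^ (6 / 5 : ℝ) ∂μ = ∫⁻ p, h p ^ (6 / 5 : ℝ) ∂(μ.prod ν) := by
    intro h hh
    rw [lintegral_prod _ (by fun_prop)]
    congr 1; ext x
    rw [← ENNReal.rpow_mul]; norm_num
  have hkx : ∀ x x', Measurable fun p : Y × Y => f (x, p.1) * g (x', p.2) * l p.1 p.2 := by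
    intro x x'; fun_prop
  have mbig : Measurable fun r : (X × Y) × (X × Y) => f r.1 * g r.2 * (k r.1.1 r.2.1 * l r.1.2 r.2.2) := by
    have a1 : Measurable fun r : (X × Y) × (X × Y) => k r.1.1 r.2.1 := 
      hk.comp (f := fun r : (X × Y) × (X × Y) => (r.1.1, r.2.1)) (by fun_prop)
    have a2 : Measurable fun r : (X × Y) × (X × Y) => l r.1.2 r.2.2 := 
      hl.comp (f := fun r : (X × Y) × (X × Y) => (r.1.2, r.2.2)) (by fun_prop)
    fun_prop
  calc ∫⁻ p, ∫⁻ q, f p * g q * (k p.1 q.1 * l p.2 q.2) ∂(μ.prod ν) ∂(μ.prod ν)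
      = ∫⁻ x, ∫⁻ y, ∫⁻ x', ∫⁻ y', f (x, y) * g (x', y') * (k x x' * l y y') ∂ν ∂μ ∂ν ∂μ := by
        rw [lintegral_prod _ (mbig.lintegral_prod_right').aemeasurable]
        congr 1; ext x; congr 1; ext y
        have hm : Measurable fun q : X × Y => f (x, y) * g q * (k x q.1 * l y q.2) := mbig.comp (measurable_prodMk_left (x := (x, y)))
        exact lintegral_prod _ hm.aemeasurable
    _ = ∫⁻ x, ∫⁻ x', ∫⁻ y, ∫⁻ y', f (x, y) * g (x', y') * (k x x' * l y y') ∂ν ∂ν ∂μ ∂μ := by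
        congr 1; ext x
        rw [lintegral_lintegral_swap]
        have : Measurable fun r : (Y × X) × Y => f (x, r.1.1) * g (r.1.2, r.2) * (k x r.1.2 * l r.1.1 r.2) := 
          mbig.comp (g := fun r : (X × Y) × (X × Y) => f r.1 * g r.2 * (k r.1.1 r.2.1 * l r.1.2 r.2.2))
            (f := fun r : (Y × X) × Y => ((x, r.1.1), (r.1.2, r.2))) (by fun_prop)
        exact this.lintegral_prod_right'.aemeasurable
    _ = ∫⁻ x, ∫⁻ x', k x x' * ∫⁻ y, ∫⁻ y', f (x, y) * g (x', y') * l y y' ∂ν ∂ν ∂μ ∂μ := by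
        congr 1; ext x; congr 1; ext x'
        rw [← lintegral_const_mul _ (hkx x x').lintegral_prod_right']
        congr 1; ext y
        have hm : Measurable fun y' : Y => f (x, y) * g (x', y') * l y y' := (hkx x x').comp (measurable_prodMk_left (x := y))
        refine Eq.trans ?_ (lintegral_const_mul _ hm)
        congr 1; ext y'; ring
    _ ≤ ∫⁻ x, ∫⁻ x', k x x' * (D * F x * G x') ∂μ ∂μ := by
        gcongr with x x'
        exact h2 (fun y => f (x, y)) (fun y => g (x', y)) (by fun_prop) (by fun_prop)
    _ = D * ∫⁻ x, ∫⁻ x', F x * G x' * k x x' ∂μ ∂μ := by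
        have m3 : Measurable fun p : X × X => F p.1 * G p.2 * k p.1 p.2 := by fun_prop
        rw [← lintegral_const_mul _ m3.lintegral_prod_right']
        congr 1; ext x
        have hm : Measurable fun x' : X => F x * G x' * k x x' := m3.comp (measurable_prodMk_left (x := x))
        refine Eq.trans ?_ (lintegral_const_mul _ hm)
        congr 1; ext x'; ring
    _ ≤ D * (C * (∫⁻ x, F x ^ (6 / 5 : ℝ) ∂μ) ^ (5 / 6 : ℝ) * (∫⁻ x, G x ^ (6 / 5 : ℝ) ∂μ) ^ (5 / 6 : ℝ)) := by
        gcongr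
        exact h1 F G mF mG
    _ = _ := by
        rw [eF f hf, eF g hg]; ring

lemma HLS.transfer {X Y : Type*} [MeasurableSpace X] [MeasurableSpace Y] {μ : Measure X} {ν : Measure Y}
    (e : X ≃ᵐ Y) (he : MeasurePreserving e μ ν) {k : Y → Y → ℝ≥0∞} {C : ℝ≥0∞} (h : HLS ν k C) :
    HLS μ (fun x y => k (e x) (e y)) C := by
  intro f g hf hg
  have := h (f ∘ e.symm) (g ∘ e.symm) (hf.comp e.symm.measurable) (hg.comp e.symm.measurable)
  simp only [Function.comp] at this
  rw [← he.lintegral_comp_emb e.measurableEmbedding, ← he.lintegral_comp_emb e.measurableEmbedding,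
     ← he.lintegral_comp_emb e.measurableEmbedding] at this
  simp only [MeasurableEquiv.symm_apply_apply] at this
  refine le_trans (le_of_eq ?_) this
  congr 1; ext x
  rw [← he.lintegral_comp_emb e.measurableEmbedding]
  simp only [MeasurableEquiv.symm_apply_apply]

/-- planar kernel -/
def k2 (x y : ℂ) : ℝ≥0∞ := k1 x.re y.re * k1 x.im y.im

/-- space-time kernel -/
def k4 (p q : (ℝ × ℂ) × ℝ) : ℝ≥0∞ := (k1 p.1.1 q.1.1 * k2 p.1.2 q.1.2) * k1 p.2 q.2

lemma measurable_k2 : Measurable (fun p : ℂ × ℂ => k2 p.1 p.2) := by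
  unfold k2
  exact (measurable_k1.comp (f := fun p : ℂ × ℂ => (p.1.re, p.2.re)) (by fun_prop)).mul
    (measurable_k1.comp (f := fun p : ℂ × ℂ => (p.1.im, p.2.im)) (by fun_prop))

lemma hls_two : HLS (volume : Measure ℂ) k2 (10 * 10) :=
  (HLS.prod measurable_k1 measurable_k1 hls_one hls_one).transfer Complex.measurableEquivRealProd
    Complex.volume_preserving_equiv_real_prod

lemma hls_four : HLS (volume : Measure ((ℝ × ℂ) × ℝ)) k4 (10 * (10 * 10) * 10) := by
  refine HLS.prod (k := fun p q : ℝ × ℂ => k1 p.1 q.1 * k2 p.2 q.2) ?_ measurable_k1 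
    (HLS.prod measurable_k1 measurable_k2 hls_one hls_two) hls_one
  exact (measurable_k1.comp (f := fun p : (ℝ × ℂ) × (ℝ × ℂ) => (p.1.1, p.2.1)) (by fun_prop)).mul
    (measurable_k2.comp (f := fun p : (ℝ × ℂ) × (ℝ × ℂ) => (p.1.2, p.2.2)) (by fun_prop))

end HLSsec


section dual
open Set

lemma integrable_bdd {E : Type*} [NormedAddCommGroup E] [MeasurableSpace E] [ProperSpace E]
    [BorelSpace E] {μ : Measure E} [IsFiniteMeasureOnCompacts μ] {h : E → ℂ} (hm : AEStronglyMeasurable h μ)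
    {M L : ℝ} (hM : ∀ x, ‖h x‖ ≤ M) (hL : ∀ x, L < ‖x‖ → h x = 0) : Integrable h μ := by
  have h1 : IntegrableOn h (Metric.closedBall 0 L) μ := by
    refine Measure.integrableOn_of_bounded (M := M) (isCompact_closedBall _ _).measure_lt_top.ne hm ?_
    exact Filter.Eventually.of_forall hM
  refine h1.integrable_of_forall_notMem_eq_zero ?_
  intro x hx
  apply hL
  simpa using hx

lemma integral_mul_conj {y : ℂ} (hy : y ≠ 0) (Ψ : ℂ → ℂ) :
    ∫ a : ℂ, Ψ (a * (starRingEnd ℂ) y) = ((((‖y‖ ^ 2)⁻¹ : ℝ)) : ℂ) * ∫ b, Ψ b := by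
  have hr : 0 < ‖y‖ := norm_pos_iff.2 hy
  have hu : ‖(starRingEnd ℂ) y / ‖y‖‖ = 1 := by
    rw [norm_div, RCLike.norm_conj]; simp [hr.ne']
  let U := rotation ⟨(starRingEnd ℂ) y / ‖y‖, mem_sphere_zero_iff_norm.2 hu⟩
  have e : ∀ a : ℂ, a * (starRingEnd ℂ) y = ‖y‖ • U a := by
    intro a
    have h1 : U a = (starRingEnd ℂ) y / ‖y‖ * a := rotation_apply _ _
    rw [h1, Complex.real_smul]
    have : (‖y‖ : ℂ) ≠ 0 := by exact_mod_cast hr.ne'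
    field_simp
  simp_rw [e]
  rw [U.measurePreserving.integral_comp U.toHomeomorph.measurableEmbedding (fun b => Ψ (‖y‖ • b)),
    Measure.integral_comp_smul, Complex.finrank_real_complex, abs_of_pos (by positivity), Complex.real_smul]

lemma planar {c m S R M : ℝ} (hc : 0 < c) (hm : 0 < m) (hcm : c ^ 2 + m ≤ 1) (hS : S ≠ 0) {y : ℂ} (hy : y ≠ 0)
    {h : ℝ → ℂ} (hh : Measurable h) (hb : ∀ s, ‖h s‖ ≤ M) :
    ‖∫ a : ℂ, ((if ‖a‖ ≤ R then 1 / (1 + ‖a‖ ^ 2) else 0 : ℝ) : ℂ) *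
        Complex.exp (Complex.I * ((S * Real.sqrt (c ^ 2 + m / (1 + ‖a‖ ^ 2)) : ℝ) : ℂ)) *
        h ((a * (starRingEnd ℂ) y).re)‖ₑ
      ≤ ∫⁻ σ, ‖h σ‖ₑ * ENNReal.ofReal (18 * (1 / (c * |S| * m)) ^ (1 / 3 : ℝ) *
          (|σ| ^ (-(1 / 3) : ℝ) * ‖y‖ ^ (-(2 / 3) : ℝ))) := by
  set r := ‖y‖ with hrdef
  have hr : 0 < r := norm_pos_iff.2 hy
  have hM : 0 ≤ M := (norm_nonneg _).trans (hb 0)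
  set Ψ : ℂ → ℂ := fun b => ((if ‖b‖ ≤ R * r then 1 / (r ^ 2 + ‖b‖ ^ 2) else 0 : ℝ) : ℂ) *
        Complex.exp (Complex.I * ((S * Real.sqrt (c ^ 2 + m * r ^ 2 / (r ^ 2 + ‖b‖ ^ 2)) : ℝ) : ℂ)) * h b.re with hΨ
  have e1 : ∀ a : ℂ, ((if ‖a‖ ≤ R then 1 / (1 + ‖a‖ ^ 2) else 0 : ℝ) : ℂ) *
        Complex.exp (Complex.I * ((S * Real.sqrt (c ^ 2 + m / (1 + ‖a‖ ^ 2)) : ℝ) : ℂ)) *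
        h ((a * (starRingEnd ℂ) y).re) = ((r ^ 2 : ℝ) : ℂ) * Ψ (a * (starRingEnd ℂ) y) := by
    intro a
    have hn : ‖a * (starRingEnd ℂ) y‖ = ‖a‖ * r := by rw [norm_mul, RCLike.norm_conj]
    simp only [hΨ, hn, mul_le_mul_iff_left₀ hr]
    have q1 : m * r ^ 2 / (r ^ 2 + (‖a‖ * r) ^ 2) = m / (1 + ‖a‖ ^ 2) := by
      field_simp
    rw [q1, ← mul_assoc, ← mul_assoc, ← Complex.ofReal_mul]
    congr 3
    split_ifs
    · field_simp
    · simp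
  simp_rw [e1]
  rw [integral_const_mul, integral_mul_conj hy, ← mul_assoc, ← Complex.ofReal_mul, mul_inv_cancel₀ (by positivity),
    Complex.ofReal_one, one_mul]
  have mΨ : Measurable Ψ := by
    refine Measurable.mul (Measurable.mul ?_ (by fun_prop)) (by fun_prop)
    exact Complex.measurable_ofReal.comp (Measurable.ite (measurableSet_le (by fun_prop) (by fun_prop)) (by fun_prop) measurable_const)
  have bΨ : ∀ b, ‖Ψ b‖ ≤ 1 / r ^ 2 * M := by
    intro b
    simp only [hΨ]
    rw [norm_mul, norm_mul, mul_comm Complex.I, Complex.norm_exp_ofReal_mul_I, mul_one, Complex.norm_real]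
    gcongr
    · split_ifs
      · rw [Real.norm_of_nonneg (by positivity)]
        gcongr; nlinarith [norm_nonneg b]
      · simp; positivity
    · exact hb _
  rw [← Complex.volume_preserving_equiv_real_prod.symm.integral_comp Complex.measurableEquivRealProd.symm.measurableEmbedding]
  have mc : Measurable fun p : ℝ × ℝ => Ψ (Complex.measurableEquivRealProd.symm p) := mΨ.comp (MeasurableEquiv.measurable _)
  have nm : ∀ p : ℝ × ℝ, ‖Complex.measurableEquivRealProd.symm p‖ ^ 2 = p.1 ^ 2 + p.2 ^ 2 := by
    intro p
    rw [← Complex.normSq_eq_norm_sq, Complex.normSq_apply]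
    simp [Complex.measurableEquivRealProd]; ring
  have hIntg : Integrable (fun p : ℝ × ℝ => Ψ (Complex.measurableEquivRealProd.symm p)) volume := by
    refine integrable_bdd (L := |R * r|) mc.aestronglyMeasurable (fun p => bΨ _) ?_
    intro p hp
    have : ¬ ‖Complex.measurableEquivRealProd.symm p‖ ≤ R * r := by
      intro hle
      have h2 := nm p
      have h3 : ‖p‖ ^ 2 ≤ (R * r) ^ 2 := by
        calc ‖p‖ ^ 2 ≤ p.1 ^ 2 + p.2 ^ 2 := by
              rw [Prod.norm_def]
              rcases max_cases ‖p.1‖ ‖p.2‖ with ⟨h, _⟩ | ⟨h, _⟩ <;> rw [h, Real.norm_eq_abs, sq_abs] <;> nlinarith [sq_nonneg p.1, sq_nonneg p.2]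
          _ ≤ _ := by rw [← h2]; gcongr
      have h4 := sq_le_sq.1 h3
      rw [abs_of_nonneg (norm_nonneg p)] at h4
      linarith
    simp only [hΨ, this, if_false]
    simp
  rw [Measure.volume_eq_prod] at hIntg ⊢
  rw [integral_prod _ hIntg]
  refine (enorm_integral_le_lintegral_enorm _).trans ?_
  apply lintegral_mono_ae
  have hne : ∀ᵐ σ : ℝ, σ ≠ 0 := by
    simp [ae_iff]
  filter_upwards [hne] with σ hσ
  have hrhs : 0 ≤ 18 * (1 / (c * |S| * m)) ^ (1 / 3 : ℝ) *
          (|σ| ^ (-(1 / 3) : ℝ) * r ^ (-(2 / 3) : ℝ)) := by positivity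
  rw [← ofReal_norm, ← ofReal_norm, ← ENNReal.ofReal_mul (norm_nonneg _)]
  apply ENNReal.ofReal_le_ofReal
  rcases le_or_gt |σ| (R * r) with hs | hs
  · set K := Real.sqrt ((R * r) ^ 2 - σ ^ 2) with hK
    have hKn : 0 ≤ (R * r) ^ 2 - σ ^ 2 := by
      have := sq_le_sq' (by linarith [abs_nonneg σ]) hs
      rw [sq_abs] at this; linarith
    have hRr : 0 ≤ R * r := (abs_nonneg _).trans hs
    have key : ∀ κ : ℝ, Ψ (Complex.measurableEquivRealProd.symm (σ, κ)) = 
        (Icc (-K) K).indicator (fun κ => Complex.exp (Complex.I * ((S * Real.sqrt (c^2 + m*r^2/(r^2+σ^2+κ^2)) : ℝ) : ℂ)) * ((1/(r^2+σ^2+κ^2) : ℝ) : ℂ) * h σ) κ := by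
      intro κ
      have hmem : ‖Complex.measurableEquivRealProd.symm (σ, κ)‖ ≤ R * r ↔ κ ∈ Icc (-K) K := by
        rw [mem_Icc, ← abs_le, ← sq_le_sq₀ (norm_nonneg _) hRr, nm, hK]
        rw [← sq_le_sq₀ (abs_nonneg κ) (Real.sqrt_nonneg _), Real.sq_sqrt hKn, sq_abs]
        constructor <;> intro <;> simp at * <;> linarith
      simp only [hΨ, hmem, nm, indicator]
      split_ifs
      · simp only [add_assoc]
        rw [mul_comm (((1 / (r ^ 2 + (σ ^ 2 + κ ^ 2)) : ℝ)) : ℂ)]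
        rfl
      · simp
    simp_rw [key]
    rw [integral_indicator measurableSet_Icc, integral_Icc_eq_integral_Ioc, ← intervalIntegral.integral_of_le (by linarith [Real.sqrt_nonneg ((R * r) ^ 2 - σ ^ 2)]),
      intervalIntegral.integral_mul_const, norm_mul, mul_comm]
    gcongr
    exact osc_full hc hm hcm hS hr hσ (Real.sqrt_nonneg _)
  · have key : ∀ κ : ℝ, Ψ (Complex.measurableEquivRealProd.symm (σ, κ)) = 0 := by
      intro κ
      have : ¬ ‖Complex.measurableEquivRealProd.symm (σ, κ)‖ ≤ R * r := by
        intro hle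
        have h1 := Complex.abs_re_le_norm (Complex.measurableEquivRealProd.symm (σ, κ))
        have h2 : (Complex.measurableEquivRealProd.symm (σ, κ)).re = σ := rfl
        rw [h2] at h1
        linarith
      simp only [hΨ, this, if_false]
      simp
    simp_rw [key]
    simp
    positivity

end dual


section dual2
open Set

/-- phase in projective coordinates -/
def qa (c m : ℝ) (a : ℂ) : ℝ := Real.sqrt (c ^ 2 + m / (1 + ‖a‖ ^ 2))

/-- truncated weight -/
def wR (R : ℝ) (a : ℂ) : ℝ := if ‖a‖ ≤ R then 1 / (1 + ‖a‖ ^ 2) else 0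

/-- plane-wave piece -/
def gz (c m S : ℝ) (G : (ℝ × ℂ) × ℝ → ℂ) (u : ℂ × ℝ) (z : ℝ × ℂ) : ℂ :=
  Complex.exp (Complex.I * ((-(z.1 * S * qa c m u.1) : ℝ) : ℂ)) * G (z, u.2 - (u.1 * (starRingEnd ℂ) z.2).re)

/-- bilinear integrand -/
def TT (c m S R : ℝ) (G : (ℝ × ℂ) × ℝ → ℂ) (u : ℂ × ℝ) (v : (ℝ × ℂ) × (ℝ × ℂ)) : ℂ :=
  (wR R u.1 : ℂ) * (gz c m S G u v.1 * (starRingEnd ℂ) (gz c m S G u v.2))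

lemma measurable_wR (R : ℝ) : Measurable (wR R) := by
  unfold wR
  exact Measurable.ite (measurableSet_le (by fun_prop) (by fun_prop)) (by fun_prop) measurable_const

lemma measurable_qa (c m : ℝ) : Measurable (qa c m) := by
  unfold qa; fun_prop

lemma wR_nonneg (R : ℝ) (a : ℂ) : 0 ≤ wR R a := by unfold wR; split_ifs <;> positivity

lemma wR_le (R : ℝ) (a : ℂ) : wR R a ≤ 1 := by
  unfold wR; split_ifs
  · rw [div_le_one (by positivity)]; nlinarith [norm_nonneg a]
  · norm_num

lemma measurable_gz {c m S : ℝ} {G : (ℝ × ℂ) × ℝ → ℂ} (hG : Measurable G) :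
    Measurable fun p : (ℂ × ℝ) × (ℝ × ℂ) => gz c m S G p.1 p.2 := by
  have := measurable_qa c m
  unfold gz
  refine Measurable.mul (by fun_prop) (hG.comp (f := fun p : (ℂ × ℝ) × (ℝ × ℂ) => (p.2, p.1.2 - (p.1.1 * (starRingEnd ℂ) p.2.2).re)) ?_)
  have h2 : Continuous fun p : (ℂ × ℝ) × (ℝ × ℂ) => (p.2, p.1.2 - (p.1.1 * (starRingEnd ℂ) p.2.2).re) := by
    have : Continuous (starRingEnd ℂ) := Complex.continuous_conj
    fun_prop
  exact h2.measurable

lemma norm_gz {c m S : ℝ} {G : (ℝ × ℂ) × ℝ → ℂ} (u : ℂ × ℝ) (z : ℝ × ℂ) :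
    ‖gz c m S G u z‖ = ‖G (z, u.2 - (u.1 * (starRingEnd ℂ) z.2).re)‖ := by
  unfold gz
  rw [norm_mul, mul_comm Complex.I, Complex.norm_exp_ofReal_mul_I, one_mul]

lemma gz_supp {c m S R L : ℝ} (hR : 0 ≤ R) (hL0 : 0 ≤ L) {G : (ℝ × ℂ) × ℝ → ℂ} (hL : ∀ p, L < ‖p‖ → G p = 0) (u : ℂ × ℝ) (z : ℝ × ℂ)
    (hu : ‖u.1‖ ≤ R) (h : gz c m S G u z ≠ 0) : ‖z‖ ≤ L ∧ ‖u.2‖ ≤ L + R * L := by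
  have h1 : G (z, u.2 - (u.1 * (starRingEnd ℂ) z.2).re) ≠ 0 := by
    intro h0; apply h; unfold gz; rw [h0, mul_zero]
  have h2 : ‖((z, u.2 - (u.1 * (starRingEnd ℂ) z.2).re) : (ℝ × ℂ) × ℝ)‖ ≤ L := by
    by_contra h3; exact h1 (hL _ (not_le.1 h3))
  rw [Prod.norm_def] at h2
  have h3 := (le_max_left _ _).trans h2
  have h4 := (le_max_right _ _).trans h2
  simp only at h3 h4
  refine ⟨h3, ?_⟩
  have h5 : ‖z.2‖ ≤ L := (norm_snd_le z).trans h3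
  have h6 : ‖(u.1 * (starRingEnd ℂ) z.2).re‖ ≤ R * L := by
    refine (Complex.abs_re_le_norm _).trans ?_
    rw [norm_mul, RCLike.norm_conj]
    gcongr
  calc ‖u.2‖ = ‖(u.2 - (u.1 * (starRingEnd ℂ) z.2).re) + (u.1 * (starRingEnd ℂ) z.2).re‖ := by rw [sub_add_cancel]
    _ ≤ _ := (norm_add_le _ _).trans (add_le_add h4 h6)

lemma measurable_TT {c m S R : ℝ} {G : (ℝ × ℂ) × ℝ → ℂ} (hG : Measurable G) :
    Measurable fun p : (ℂ × ℝ) × ((ℝ × ℂ) × (ℝ × ℂ)) => TT c m S R G p.1 p.2 := by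
  have h1 := measurable_wR R
  have h2 := measurable_gz (c := c) (m := m) (S := S) hG
  have h3 : Measurable fun p : (ℂ × ℝ) × ((ℝ × ℂ) × (ℝ × ℂ)) => gz c m S G p.1 p.2.1 :=
    h2.comp (f := fun p : (ℂ × ℝ) × ((ℝ × ℂ) × (ℝ × ℂ)) => (p.1, p.2.1)) (by fun_prop)
  have h4 : Measurable fun p : (ℂ × ℝ) × ((ℝ × ℂ) × (ℝ × ℂ)) => gz c m S G p.1 p.2.2 :=
    h2.comp (f := fun p : (ℂ × ℝ) × ((ℝ × ℂ) × (ℝ × ℂ)) => (p.1, p.2.2)) (by fun_prop)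
  have h5 : Measurable (starRingEnd ℂ) := Complex.continuous_conj.measurable
  unfold TT
  fun_prop

lemma norm_TT {c m S R M : ℝ} {G : (ℝ × ℂ) × ℝ → ℂ} (hM : ∀ p, ‖G p‖ ≤ M) (u : ℂ × ℝ) (v : (ℝ × ℂ) × (ℝ × ℂ)) :
    ‖TT c m S R G u v‖ ≤ 1 * (M * M) := by
  have hM0 : 0 ≤ M := (norm_nonneg _).trans (hM 0)
  unfold TT
  rw [norm_mul, norm_mul, RCLike.norm_conj, norm_gz, norm_gz, Complex.norm_real, Real.norm_of_nonneg (wR_nonneg _ _)]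
  gcongr
  · exact wR_le _ _
  · exact hM _
  · exact hM _

lemma TT_supp {c m S R L : ℝ} (hR : 0 ≤ R) (hL0 : 0 ≤ L) {G : (ℝ × ℂ) × ℝ → ℂ} (hL : ∀ p, L < ‖p‖ → G p = 0)
    (u : ℂ × ℝ) (v : (ℝ × ℂ) × (ℝ × ℂ)) (h : TT c m S R G u v ≠ 0) : ‖u‖ ≤ R + L + R * L ∧ ‖v‖ ≤ L := by
  unfold TT at h
  have h1 : wR R u.1 ≠ 0 := by intro h0; apply h; simp [h0]
  have h2 : gz c m S G u v.1 ≠ 0 := by intro h0; apply h; simp [h0]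
  have h3 : gz c m S G u v.2 ≠ 0 := by intro h0; apply h; simp [h0]
  have h4 : ‖u.1‖ ≤ R := by
    by_contra h0; apply h1; unfold wR; rw [if_neg h0]
  have h5 := gz_supp hR hL0 hL u v.1 h4 h2
  have h6 := gz_supp hR hL0 hL u v.2 h4 h3
  have : 0 ≤ R * L := by positivity
  constructor
  · rw [Prod.norm_def]; exact max_le (by linarith) (by linarith [h5.2])
  · rw [Prod.norm_def]; exact max_le h5.1 h6.1

lemma TT_int {c m S R L M : ℝ} (hR : 0 ≤ R) (hL0 : 0 ≤ L) {G : (ℝ × ℂ) × ℝ → ℂ} (hG : Measurable G)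
    (hM : ∀ p, ‖G p‖ ≤ M) (hL : ∀ p, L < ‖p‖ → G p = 0) :
    Integrable (fun p : (ℂ × ℝ) × ((ℝ × ℂ) × (ℝ × ℂ)) => TT c m S R G p.1 p.2) := by
  refine integrable_bdd (L := R + L + R * L) (measurable_TT hG).aestronglyMeasurable (fun p => norm_TT hM _ _) ?_
  intro p hp
  by_contra h0
  have := TT_supp hR hL0 hL _ _ h0
  rw [Prod.norm_def] at hp
  rcases lt_max_iff.1 hp with h | h
  · linarith
  · have : 0 ≤ R * L := by positivity
    linarith

lemma TT_int_u {c m S R L M : ℝ} (hR : 0 ≤ R) (hL0 : 0 ≤ L) {G : (ℝ × ℂ) × ℝ → ℂ} (hG : Measurable G)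
    (hM : ∀ p, ‖G p‖ ≤ M) (hL : ∀ p, L < ‖p‖ → G p = 0) (v : (ℝ × ℂ) × (ℝ × ℂ)) :
    Integrable (fun u : ℂ × ℝ => TT c m S R G u v) := by
  refine integrable_bdd (L := R + L + R * L) 
    ((measurable_TT hG).comp (f := fun u => (u, v)) (by fun_prop)).aestronglyMeasurable (fun p => norm_TT hM _ _) ?_
  intro p hp
  by_contra h0
  have := TT_supp hR hL0 hL _ _ h0
  linarith

lemma TT_shift {c m S R : ℝ} {G : (ℝ × ℂ) × ℝ → ℂ} (a : ℂ) (τ : ℝ) (z z' : ℝ × ℂ) :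
    TT c m S R G (a, τ + (a * (starRingEnd ℂ) z.2).re) (z, z') = 
      G (z, τ) * ((wR R a : ℂ) * Complex.exp (Complex.I * (((-(S * (z.1 - z'.1))) * qa c m a : ℝ) : ℂ)) * 
        (starRingEnd ℂ) (G (z', τ + (a * (starRingEnd ℂ) (z.2 - z'.2)).re))) := by
  unfold TT gz
  simp only
  rw [map_mul, ← Complex.exp_conj, map_mul, Complex.conj_I, Complex.conj_ofReal]
  have e1 : τ + (a * (starRingEnd ℂ) z.2).re - (a * (starRingEnd ℂ) z.2).re = τ := by ring
  have e2 : τ + (a * (starRingEnd ℂ) z.2).re - (a * (starRingEnd ℂ) z'.2).re = τ + (a * (starRingEnd ℂ) (z.2 - z'.2)).re := by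
    rw [map_sub, mul_sub, Complex.sub_re]; ring
  have e3 : Complex.exp (Complex.I * (((-(S * (z.1 - z'.1))) * qa c m a : ℝ) : ℂ)) = 
      Complex.exp (Complex.I * ((-(z.1 * S * qa c m a) : ℝ) : ℂ)) * Complex.exp (-Complex.I * ((-(z'.1 * S * qa c m a) : ℝ) : ℂ)) := by
    rw [← Complex.exp_add]; congr 1; push_cast; ring
  rw [e1, e2, e3]; ring

lemma TT_pair {c m S R L M : ℝ} (hc : 0 < c) (hm : 0 < m) (hcm : c ^ 2 + m ≤ 1) (hR : 0 ≤ R) (hL0 : 0 ≤ L)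
    {G : (ℝ × ℂ) × ℝ → ℂ} (hG : Measurable G)
    (hM : ∀ p, ‖G p‖ ≤ M) (hL : ∀ p, L < ‖p‖ → G p = 0) (z z' : ℝ × ℂ) (hS : S * (z.1 - z'.1) ≠ 0) (hz : z.2 ≠ z'.2) :
    ‖∫ u : ℂ × ℝ, TT c m S R G u (z, z')‖ₑ ≤ ∫⁻ τ : ℝ, ∫⁻ x : ℝ, ‖G (z, τ)‖ₑ * (‖G (z', x)‖ₑ * 
      ENNReal.ofReal (18 * (1 / (c * |S * (z.1 - z'.1)| * m)) ^ (1 / 3 : ℝ) *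
          (|x - τ| ^ (-(1 / 3) : ℝ) * ‖z.2 - z'.2‖ ^ (-(2 / 3) : ℝ)))) := by
  have hM0 : 0 ≤ M := (norm_nonneg _).trans (hM 0)
  have i1 := TT_int_u (c := c) (m := m) (S := S) hR hL0 hG hM hL (z, z')
  rw [Measure.volume_eq_prod] at i1
  rw [Measure.volume_eq_prod, integral_prod _ i1]
  have e1 : ∀ a : ℂ, ∫ τ : ℝ, TT c m S R G (a, τ) (z, z') = ∫ τ : ℝ, TT c m S R G (a, τ + (a * (starRingEnd ℂ) z.2).re) (z, z') :=
    fun a => (integral_add_right_eq_self (fun τ => TT c m S R G (a, τ) (z, z')) _).symm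
  simp_rw [e1]
  have i2 : Integrable (Function.uncurry fun (a : ℂ) (τ : ℝ) => TT c m S R G (a, τ + (a * (starRingEnd ℂ) z.2).re) (z, z')) 
      ((volume : Measure ℂ).prod (volume : Measure ℝ)) := by
    have hc1 : Continuous fun p : ℂ × ℝ => (((p.1, p.2 + (p.1 * (starRingEnd ℂ) z.2).re), (z, z')) : (ℂ × ℝ) × ((ℝ × ℂ) × (ℝ × ℂ))) := by fun_prop
    refine integrable_bdd (E := ℂ × ℝ) (L := R + L) 
      ((measurable_TT (c := c) (m := m) (S := S) (R := R) hG).comp hc1.measurable).aestronglyMeasurable (fun p => norm_TT hM _ _) ?_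
    rintro ⟨a, τ⟩ hp
    simp only [Function.uncurry]
    rw [TT_shift]
    rw [Prod.norm_def] at hp
    rcases lt_max_iff.1 hp with h | h
    · have : wR R a = 0 := by
        unfold wR; rw [if_neg]; simp at h ⊢; linarith
      simp [this]
    · have : G (z, τ) = 0 := by
        apply hL; rw [Prod.norm_def]; apply lt_max_of_lt_right; simp at h ⊢; linarith
      simp [this]
  rw [integral_integral_swap i2]
  refine (enorm_integral_le_lintegral_enorm _).trans ?_
  apply lintegral_mono
  intro τ
  simp only [TT_shift]
  rw [integral_const_mul, enorm_mul]
  have hk : Measurable fun s : ℝ => (starRingEnd ℂ) (G (z', τ + s)) := 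
    Complex.continuous_conj.measurable.comp (hG.comp (by fun_prop))
  have pl := planar (R := R) (M := M) hc hm hcm (neg_ne_zero.2 hS) (sub_ne_zero.2 hz) hk (fun s => by rw [RCLike.norm_conj]; exact hM _)
  simp only [abs_neg] at pl
  have hmx : Measurable fun x : ℝ => ‖G (z', x)‖ₑ * 
      ENNReal.ofReal (18 * (1 / (c * |S * (z.1 - z'.1)| * m)) ^ (1 / 3 : ℝ) *
          (|x - τ| ^ (-(1 / 3) : ℝ) * ‖z.2 - z'.2‖ ^ (-(2 / 3) : ℝ))) := by
    fun_prop
  rw [lintegral_const_mul _ hmx]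
  gcongr
  refine pl.trans (le_of_eq (Eq.trans ?_ (lintegral_add_left_eq_self _ τ)))
  congr 1; ext s
  rw [add_sub_cancel_left, ← ofReal_norm, RCLike.norm_conj, ofReal_norm]

end dual2


section dual3
open Set

lemma kernel_le {c m S : ℝ} (hc : 0 < c) (hm : 0 < m) (z z' : ℝ × ℂ) (τ x : ℝ)
    (h2 : z.2.re ≠ z'.2.re) (h3 : z.2.im ≠ z'.2.im) :
    ENNReal.ofReal (18 * (1 / (c * |S * (z.1 - z'.1)| * m)) ^ (1 / 3 : ℝ) *
          (|x - τ| ^ (-(1 / 3) : ℝ) * ‖z.2 - z'.2‖ ^ (-(2 / 3) : ℝ))) ≤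
      ENNReal.ofReal (18 * (1 / (c * |S| * m)) ^ (1 / 3 : ℝ)) * k4 (z, τ) (z', x) := by
  unfold k4 k2 k1
  simp only
  rw [← ENNReal.ofReal_mul (by positivity), ← ENNReal.ofReal_mul (by positivity), ← ENNReal.ofReal_mul (by positivity),
    ← ENNReal.ofReal_mul (by positivity)]
  apply ENNReal.ofReal_le_ofReal
  have e1 : (1 / (c * |S * (z.1 - z'.1)| * m)) ^ (1 / 3 : ℝ) = (1 / (c * |S| * m)) ^ (1 / 3 : ℝ) * |z.1 - z'.1| ^ (-(1 / 3) : ℝ) := by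
    rw [abs_mul, Real.rpow_neg (abs_nonneg _), ← Real.inv_rpow (abs_nonneg _), ← Real.mul_rpow (by positivity) (by positivity)]
    congr 1
    rw [one_div, one_div, ← mul_inv]; congr 1; ring
  have e2 : ‖z.2 - z'.2‖ ^ (-(2 / 3) : ℝ) ≤ |z.2.re - z'.2.re| ^ (-(1 / 3) : ℝ) * |z.2.im - z'.2.im| ^ (-(1 / 3) : ℝ) := by
    have p1 : 0 < |z.2.re - z'.2.re| := abs_pos.2 (sub_ne_zero.2 h2)
    have p2 : 0 < |z.2.im - z'.2.im| := abs_pos.2 (sub_ne_zero.2 h3)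
    have q1 : |z.2.re - z'.2.re| ≤ ‖z.2 - z'.2‖ := by simpa using Complex.abs_re_le_norm (z.2 - z'.2)
    have q2 : |z.2.im - z'.2.im| ≤ ‖z.2 - z'.2‖ := by simpa using Complex.abs_im_le_norm (z.2 - z'.2)
    have p3 : 0 < ‖z.2 - z'.2‖ := p1.trans_le q1
    calc ‖z.2 - z'.2‖ ^ (-(2 / 3) : ℝ) = ‖z.2 - z'.2‖ ^ (-(1 / 3) : ℝ) * ‖z.2 - z'.2‖ ^ (-(1 / 3) : ℝ) := by
          rw [← Real.rpow_add p3]; norm_num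
      _ ≤ _ := by
        gcongr ?_ * ?_
        · exact Real.rpow_le_rpow_of_nonpos p1 q1 (by norm_num)
        · exact Real.rpow_le_rpow_of_nonpos p2 q2 (by norm_num)
  rw [e1, abs_sub_comm τ x]
  calc _ ≤ 18 * ((1 / (c * |S| * m)) ^ (1 / 3 : ℝ) * |z.1 - z'.1| ^ (-(1 / 3) : ℝ)) * (|x - τ| ^ (-(1 / 3) : ℝ) * 
        (|z.2.re - z'.2.re| ^ (-(1 / 3) : ℝ) * |z.2.im - z'.2.im| ^ (-(1 / 3) : ℝ))) := by gcongr
    _ = _ := by ring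

lemma ae_ne_Z (z : ℝ × ℂ) : ∀ᵐ z' : ℝ × ℂ, z.1 ≠ z'.1 ∧ z.2.re ≠ z'.2.re ∧ z.2.im ≠ z'.2.im := by
  have h0 : ∀ s : ℝ, ∀ᵐ t : ℝ, s ≠ t := by
    intro s
    have : {a : ℝ | ¬ s ≠ a} = {s} := by ext; simp [eq_comm]
    rw [ae_iff, this]; simp
  have q1 : Measure.QuasiMeasurePreserving (Prod.fst : ℝ × ℂ → ℝ) volume volume := Measure.quasiMeasurePreserving_fst
  have q2 : Measure.QuasiMeasurePreserving (Prod.snd : ℝ × ℂ → ℂ) volume volume := Measure.quasiMeasurePreserving_snd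
  have q3 : Measure.QuasiMeasurePreserving (Prod.fst : ℝ × ℝ → ℝ) volume volume := Measure.quasiMeasurePreserving_fst
  have q4 : Measure.QuasiMeasurePreserving (Prod.snd : ℝ × ℝ → ℝ) volume volume := Measure.quasiMeasurePreserving_snd
  have q5 := Complex.volume_preserving_equiv_real_prod.quasiMeasurePreserving
  filter_upwards [q1.ae (h0 z.1), ((q3.comp q5).comp q2).ae (h0 z.2.re), ((q4.comp q5).comp q2).ae (h0 z.2.im)] with z' a b c
  exact ⟨a, b, c⟩

lemma measurable_k4 : Measurable fun p : ((ℝ × ℂ) × ℝ) × ((ℝ × ℂ) × ℝ) => k4 p.1 p.2 := by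
  unfold k4 k2 k1
  fun_prop

lemma reorder4 {X Y : Type*} [MeasurableSpace X] [MeasurableSpace Y] {μ : Measure X} {ν : Measure Y}
    [SFinite μ] [SFinite ν] {K : (X × Y) × (X × Y) → ℝ≥0∞} (hK : Measurable K) :
    ∫⁻ z, ∫⁻ z', ∫⁻ τ, ∫⁻ x, K ((z, τ), (z', x)) ∂ν ∂ν ∂μ ∂μ = ∫⁻ p, ∫⁻ q, K (p, q) ∂(μ.prod ν) ∂(μ.prod ν) := by
  rw [lintegral_prod _ hK.lintegral_prod_right'.aemeasurable]
  congr 1; ext z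
  rw [lintegral_lintegral_swap]
  · congr 1; ext τ
    have hm2 : Measurable fun q : X × Y => K ((z, τ), q) := hK.comp measurable_prodMk_left
    exact (lintegral_prod _ hm2.aemeasurable).symm
  · have hm1 : Measurable fun p : (X × Y) × Y => K ((z, p.1.2), (p.1.1, p.2)) := hK.comp (by fun_prop)
    exact hm1.lintegral_prod_right'.aemeasurable

set_option maxHeartbeats 200000 in
lemma TT_bound {c m S R L M : ℝ} (hc : 0 < c) (hm : 0 < m) (hcm : c ^ 2 + m ≤ 1) (hR : 0 ≤ R) (hL0 : 0 ≤ L)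
    {G : (ℝ × ℂ) × ℝ → ℂ} (hG : Measurable G)
    (hM : ∀ p, ‖G p‖ ≤ M) (hL : ∀ p, L < ‖p‖ → G p = 0) (hS : S ≠ 0) :
    ‖∫ u : ℂ × ℝ, ∫ v, TT c m S R G u v‖ₑ ≤ ENNReal.ofReal (18 * (1 / (c * |S| * m)) ^ (1 / 3 : ℝ)) * 
      (10 * (10 * 10) * 10 * (∫⁻ p, ‖G p‖ₑ ^ (6 / 5 : ℝ)) ^ (5 / 6 : ℝ) * (∫⁻ p, ‖G p‖ₑ ^ (6 / 5 : ℝ)) ^ (5 / 6 : ℝ)) := by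
  have i0 := TT_int (c := c) (m := m) (S := S) hR hL0 hG hM hL
  rw [Measure.volume_eq_prod] at i0
  rw [integral_integral_swap i0]
  refine (enorm_integral_le_lintegral_enorm _).trans ?_
  have ms : AEMeasurable (fun v => ‖∫ u : ℂ × ℝ, TT c m S R G u v‖ₑ)
      ((volume : Measure (ℝ × ℂ)).prod (volume : Measure (ℝ × ℂ))) := 
    i0.swap.integral_prod_left.aestronglyMeasurable.enorm
  refine (le_of_eq (lintegral_prod _ ms)).trans ?_
  set D := ENNReal.ofReal (18 * (1 / (c * |S| * m)) ^ (1 / 3 : ℝ)) with hD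
  have mk := measurable_k4
  have mb : Measurable fun p : ((ℝ × ℂ) × ℝ) × ((ℝ × ℂ) × ℝ) => ‖G p.1‖ₑ * ‖G p.2‖ₑ * k4 p.1 p.2 := by fun_prop
  calc _ ≤ ∫⁻ z : ℝ × ℂ, ∫⁻ z' : ℝ × ℂ, ∫⁻ τ : ℝ, ∫⁻ x : ℝ, D * (‖G (z, τ)‖ₑ * ‖G (z', x)‖ₑ * k4 (z, τ) (z', x)) := by
        apply lintegral_mono; intro z
        apply lintegral_mono_ae
        filter_upwards [ae_ne_Z z] with z' hz
        refine (TT_pair hc hm hcm hR hL0 hG hM hL z z' (mul_ne_zero hS (sub_ne_zero.2 hz.1)) (fun h => hz.2.1 (by rw [h]))).trans ?_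
        apply lintegral_mono; intro τ
        apply lintegral_mono; intro x
        simp only
        calc _ ≤ ‖G (z, τ)‖ₑ * (‖G (z', x)‖ₑ * (D * k4 (z, τ) (z', x))) := by
              gcongr; exact kernel_le hc hm z z' τ x hz.2.1 hz.2.2
          _ = _ := by ring
    _ = ∫⁻ p : (ℝ × ℂ) × ℝ, ∫⁻ q : (ℝ × ℂ) × ℝ, D * (‖G p‖ₑ * ‖G q‖ₑ * k4 p q) := 
        reorder4 (K := fun p : ((ℝ × ℂ) × ℝ) × ((ℝ × ℂ) × ℝ) => D * (‖G p.1‖ₑ * ‖G p.2‖ₑ * k4 p.1 p.2)) (mb.const_mul D)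
    _ = D * ∫⁻ p : (ℝ × ℂ) × ℝ, ∫⁻ q : (ℝ × ℂ) × ℝ, (‖G p‖ₑ * ‖G q‖ₑ * k4 p q) := by
        rw [← lintegral_const_mul' _ _ ENNReal.ofReal_ne_top]
        congr 1; ext p
        rw [← lintegral_const_mul' _ _ ENNReal.ofReal_ne_top]
    _ ≤ _ := by
        gcongr
        exact hls_four (fun p => ‖G p‖ₑ) (fun p => ‖G p‖ₑ) (by fun_prop) (by fun_prop)

end dual3


section dual4
open Set

/-- partially transformed density -/
def PhiA (c m S : ℝ) (G : (ℝ × ℂ) × ℝ → ℂ) (u : ℂ × ℝ) : ℂ := ∫ z : ℝ × ℂ, gz c m S G u z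

lemma int_TT {c m S R : ℝ} {G : (ℝ × ℂ) × ℝ → ℂ} (u : ℂ × ℝ) :
    ∫ v, TT c m S R G u v = ((wR R u.1 * ‖PhiA c m S G u‖ ^ 2 : ℝ) : ℂ) := by
  unfold TT PhiA
  rw [integral_const_mul, Measure.volume_eq_prod,
    integral_prod_mul (fun z => gz c m S G u z) (fun z => (starRingEnd ℂ) (gz c m S G u z)),
    integral_conj, Complex.mul_conj, Complex.normSq_eq_norm_sq]
  push_cast; rfl

lemma Phi_bound {c m S R L M : ℝ} (hc : 0 < c) (hm : 0 < m) (hcm : c ^ 2 + m ≤ 1) (hR : 0 ≤ R) (hL0 : 0 ≤ L)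
    {G : (ℝ × ℂ) × ℝ → ℂ} (hG : Measurable G)
    (hM : ∀ p, ‖G p‖ ≤ M) (hL : ∀ p, L < ‖p‖ → G p = 0) (hS : S ≠ 0) :
    ∫⁻ u : ℂ × ℝ, ENNReal.ofReal (wR R u.1) * ‖PhiA c m S G u‖ₑ ^ 2 ≤ ENNReal.ofReal (18 * (1 / (c * |S| * m)) ^ (1 / 3 : ℝ)) * 
      (10 * (10 * 10) * 10 * (∫⁻ p, ‖G p‖ₑ ^ (6 / 5 : ℝ)) ^ (5 / 6 : ℝ) * (∫⁻ p, ‖G p‖ₑ ^ (6 / 5 : ℝ)) ^ (5 / 6 : ℝ)) := by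
  refine le_trans (le_of_eq ?_) (TT_bound hc hm hcm hR hL0 hG hM hL hS)
  have i0 := (TT_int (c := c) (m := m) (S := S) hR hL0 hG hM hL)
  rw [Measure.volume_eq_prod] at i0
  have i1 := i0.integral_prod_left
  simp_rw [int_TT] at i1 ⊢
  have i2 : Integrable (fun u : ℂ × ℝ => wR R u.1 * ‖PhiA c m S G u‖ ^ 2) := by
    exact i1.re
  have hnn : ∀ u : ℂ × ℝ, 0 ≤ wR R u.1 * ‖PhiA c m S G u‖ ^ 2 := fun u => mul_nonneg (wR_nonneg _ _) (by positivity)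
  rw [integral_complex_ofReal, ← ofReal_norm, Complex.norm_real, Real.norm_of_nonneg (integral_nonneg hnn),
    ofReal_integral_eq_lintegral_ofReal i2 (Filter.Eventually.of_forall hnn)]
  congr 1; ext u
  rw [ENNReal.ofReal_mul (wR_nonneg _ _), ← ofReal_norm, ENNReal.ofReal_pow (norm_nonneg _)]

lemma measurable_Phi {c m S : ℝ} {G : (ℝ × ℂ) × ℝ → ℂ} (hG : Measurable G) : Measurable (PhiA c m S G) := by
  have := (measurable_gz (c := c) (m := m) (S := S) hG).stronglyMeasurable.integral_prod_right' (ν := volume)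
  exact this.measurable

lemma Phi_bound' {c m S L M : ℝ} (hc : 0 < c) (hm : 0 < m) (hcm : c ^ 2 + m ≤ 1) (hL0 : 0 ≤ L)
    {G : (ℝ × ℂ) × ℝ → ℂ} (hG : Measurable G)
    (hM : ∀ p, ‖G p‖ ≤ M) (hL : ∀ p, L < ‖p‖ → G p = 0) (hS : S ≠ 0) :
    ∫⁻ a : ℂ, ENNReal.ofReal (1 / (1 + ‖a‖ ^ 2)) * ∫⁻ τ : ℝ, ‖PhiA c m S G (a, τ)‖ₑ ^ 2 ≤ 
     ENNReal.ofReal (18 * (1 / (c * |S| * m)) ^ (1 / 3 : ℝ)) * 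
      (10 * (10 * 10) * 10 * (∫⁻ p, ‖G p‖ₑ ^ (6 / 5 : ℝ)) ^ (5 / 6 : ℝ) * (∫⁻ p, ‖G p‖ₑ ^ (6 / 5 : ℝ)) ^ (5 / 6 : ℝ)) := by
  have mP := measurable_Phi (c := c) (m := m) (S := S) hG
  have mW := measurable_wR
  have e : ∀ a : ℂ, ENNReal.ofReal (1 / (1 + ‖a‖ ^ 2)) * ∫⁻ τ : ℝ, ‖PhiA c m S G (a, τ)‖ₑ ^ 2 
      = ⨆ n : ℕ, ENNReal.ofReal (wR n a) * ∫⁻ τ : ℝ, ‖PhiA c m S G (a, τ)‖ₑ ^ 2 := by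
    intro a
    rw [← ENNReal.iSup_mul]
    congr 1
    apply le_antisymm
    · obtain ⟨n, hn⟩ := exists_nat_ge ‖a‖
      refine le_trans (le_of_eq ?_) (le_iSup _ n)
      rw [wR, if_pos hn]
    · apply iSup_le; intro n
      apply ENNReal.ofReal_le_ofReal
      unfold wR; split_ifs
      · rfl
      · positivity
  have mI : Measurable fun a : ℂ => ∫⁻ τ : ℝ, ‖PhiA c m S G (a, τ)‖ₑ ^ 2 := 
    Measurable.lintegral_prod_right' (f := fun u : ℂ × ℝ => ‖PhiA c m S G u‖ₑ ^ 2) (by fun_prop)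
  simp_rw [e]
  rw [lintegral_iSup]
  · apply iSup_le; intro n
    refine le_trans (le_of_eq ?_) (Phi_bound hc hm hcm (Nat.cast_nonneg n) hL0 hG hM hL hS)
    rw [Measure.volume_eq_prod, lintegral_prod _ (by fun_prop)]
    congr 1; ext a
    exact (lintegral_const_mul _ (by fun_prop)).symm
  · intro n; fun_prop
  · intro n k hnk a
    simp only
    gcongr
    unfold wR
    have hh : (n:ℝ) ≤ k := by exact_mod_cast hnk
    split_ifs with h1 h2
    · rfl
    · exact absurd (h1.trans hh) h2
    · positivity
    · rfl

/-- space-time Fourier transform restricted to the characteristic surface -/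
def Ghat (c m S : ℝ) (G : (ℝ × ℂ) × ℝ → ℂ) (ζ : ℂ × ℝ) : ℂ :=
  ∫ p : (ℝ × ℂ) × ℝ, Complex.exp (-Complex.I * (((p.1.2 * (starRingEnd ℂ) ζ.1).re + p.2 * ζ.2 + 
    p.1.1 * S * Real.sqrt (c ^ 2 + m * ζ.2 ^ 2 / (ζ.2 ^ 2 + ‖ζ.1‖ ^ 2)) : ℝ) : ℂ)) * G p

lemma measurable_Ghat {c m S : ℝ} {G : (ℝ × ℂ) × ℝ → ℂ} (hG : Measurable G) : Measurable (Ghat c m S G) := by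
  have h5 : Measurable (starRingEnd ℂ) := Complex.continuous_conj.measurable
  have : Measurable fun q : (ℂ × ℝ) × ((ℝ × ℂ) × ℝ) => 
    Complex.exp (-Complex.I * (((q.2.1.2 * (starRingEnd ℂ) q.1.1).re + q.2.2 * q.1.2 + 
    q.2.1.1 * S * Real.sqrt (c ^ 2 + m * q.1.2 ^ 2 / (q.1.2 ^ 2 + ‖q.1.1‖ ^ 2)) : ℝ) : ℂ)) * G q.2 := by fun_prop
  exact this.stronglyMeasurable.integral_prod_right'.measurable

lemma gz_int_a {c m S L M : ℝ} (hL0 : 0 ≤ L) {G : (ℝ × ℂ) × ℝ → ℂ} (hG : Measurable G)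
    (hM : ∀ p, ‖G p‖ ≤ M) (hL : ∀ p, L < ‖p‖ → G p = 0) (a : ℂ) :
    Integrable (fun p : (ℝ × ℂ) × ℝ => gz c m S G (a, p.2) p.1) := by
  refine integrable_bdd (L := L + ‖a‖ * L) (M := M)
    ((measurable_gz hG).comp (f := fun p : (ℝ × ℂ) × ℝ => ((a, p.2), p.1)) (by fun_prop)).aestronglyMeasurable 
    (fun p => by rw [norm_gz]; exact hM _) ?_
  intro p hp
  by_contra h0
  have := gz_supp (norm_nonneg a) hL0 hL (a, p.2) p.1 le_rfl h0
  have h1 : ‖p‖ ≤ L + ‖a‖ * L := by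
    rw [Prod.norm_def]; exact max_le (by nlinarith [norm_nonneg a, this.1]) this.2
  linarith

lemma Ghat_eq {c m S L M : ℝ} (hL0 : 0 ≤ L) {G : (ℝ × ℂ) × ℝ → ℂ} (hG : Measurable G)
    (hM : ∀ p, ‖G p‖ ≤ M) (hL : ∀ p, L < ‖p‖ → G p = 0) (a : ℂ) {ρ : ℝ} (hρ : ρ ≠ 0) :
    Ghat c m S G (ρ • a, ρ) = ∫ τ : ℝ, Complex.exp (-Complex.I * ((ρ * τ : ℝ) : ℂ)) * PhiA c m S G (a, τ) := by
  have i0 := gz_int_a (c := c) (m := m) (S := S) hL0 hG hM hL a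
  have i1 : Integrable (fun p : (ℝ × ℂ) × ℝ => Complex.exp (-Complex.I * ((ρ * p.2 : ℝ) : ℂ)) * gz c m S G (a, p.2) p.1) := by
    refine i0.bdd_mul (c := 1) (by fun_prop) ?_
    filter_upwards with p
    rw [neg_mul, ← mul_neg, mul_comm Complex.I, ← Complex.ofReal_neg, Complex.norm_exp_ofReal_mul_I]
  have iG : Integrable (fun p : (ℝ × ℂ) × ℝ => Complex.exp (-Complex.I * (((p.1.2 * (starRingEnd ℂ) (ρ • a)).re + p.2 * ρ + 
    p.1.1 * S * Real.sqrt (c ^ 2 + m * ρ ^ 2 / (ρ ^ 2 + ‖ρ • a‖ ^ 2)) : ℝ) : ℂ)) * G p) := by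
    refine (integrable_bdd (μ := volume) hG.aestronglyMeasurable hM hL).bdd_mul (c := 1) (by fun_prop) ?_
    filter_upwards with p
    rw [neg_mul, ← mul_neg, mul_comm Complex.I, ← Complex.ofReal_neg, Complex.norm_exp_ofReal_mul_I]
  have hq : Real.sqrt (c ^ 2 + m * ρ ^ 2 / (ρ ^ 2 + ‖ρ • a‖ ^ 2)) = qa c m a := by
    unfold qa; congr 2
    rw [norm_smul, mul_pow, Real.norm_eq_abs, sq_abs]
    field_simp
  unfold Ghat PhiA
  simp only
  rw [Measure.volume_eq_prod] at iG i1
  rw [Measure.volume_eq_prod, integral_prod _ iG]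
  simp_rw [← integral_const_mul]
  rw [integral_integral_swap (f := fun (τ : ℝ) (z : ℝ × ℂ) => Complex.exp (-Complex.I * ((ρ * τ : ℝ) : ℂ)) * gz c m S G (a, τ) z) i1.swap]
  congr 1; ext z
  rw [← integral_sub_right_eq_self _ ((a * (starRingEnd ℂ) z.2).re)]
  congr 1; ext τ
  simp only [hq, gz]
  rw [← mul_assoc, ← Complex.exp_add]
  congr 2
  have : (z.2 * (starRingEnd ℂ) (ρ • a)).re = ρ * (a * (starRingEnd ℂ) z.2).re := by
    simp; ring
  rw [this]
  push_cast; ring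

lemma Phi_memLp {c m S L M : ℝ} (hL0 : 0 ≤ L) {G : (ℝ × ℂ) × ℝ → ℂ} (hG : Measurable G)
    (hM : ∀ p, ‖G p‖ ≤ M) (hL : ∀ p, L < ‖p‖ → G p = 0) (a : ℂ) :
    Integrable (fun τ => PhiA c m S G (a, τ)) ∧ MemLp (fun τ => PhiA c m S G (a, τ)) 2 := by
  have mP : Measurable fun τ => PhiA c m S G (a, τ) := (measurable_Phi hG).comp (by fun_prop)
  have supp : ∀ τ z, gz c m S G (a, τ) z ≠ 0 → _ := fun τ z => gz_supp (norm_nonneg a) hL0 hL (a, τ) z le_rfl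
  have b : ∀ τ, ‖PhiA c m S G (a, τ)‖ ≤ M * (volume : Measure (ℝ × ℂ)).real (Metric.closedBall 0 L) := by
    intro τ
    unfold PhiA
    rw [← setIntegral_eq_integral_of_forall_compl_eq_zero (s := Metric.closedBall 0 L)]
    · exact norm_setIntegral_le_of_norm_le_const (isCompact_closedBall _ _).measure_lt_top
        (fun z _ => by rw [norm_gz]; exact hM _)
    · intro z hz
      by_contra h0
      apply hz
      simpa using (supp τ z h0).1
  have s : ∀ τ : ℝ, L + ‖a‖ * L < ‖τ‖ → PhiA c m S G (a, τ) = 0 := by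
    intro τ hτ
    unfold PhiA
    rw [← integral_zero (ℝ × ℂ) ℂ]
    congr 1; ext z
    by_contra h0
    have := (supp τ z h0).2
    simp only at this
    linarith
  refine ⟨integrable_bdd mP.aestronglyMeasurable b s, ?_⟩
  rw [memLp_two_iff_integrable_sq_norm mP.aestronglyMeasurable]
  have := integrable_bdd (μ := volume) (h := fun τ => ((‖PhiA c m S G (a, τ)‖ ^ 2 : ℝ) : ℂ)) (L := L + ‖a‖ * L)
    (M := (M * (volume : Measure (ℝ × ℂ)).real (Metric.closedBall 0 L)) ^ 2) ((Complex.measurable_ofReal.comp (mP.norm.pow_const 2)).aestronglyMeasurable)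
    (fun τ => by rw [Complex.norm_real, norm_pow, norm_norm]; gcongr; exact b τ) (fun τ hτ => by rw [s τ hτ]; simp)
  exact this.re

end dual4


section dual5
open Set

lemma ae_ne_zero_real : ∀ᵐ ρ : ℝ, ρ ≠ 0 := by simp [ae_iff]

lemma dual_estimate {c m S L M : ℝ} (hc : 0 < c) (hm : 0 < m) (hcm : c ^ 2 + m ≤ 1) (hL0 : 0 ≤ L)
    {G : (ℝ × ℂ) × ℝ → ℂ} (hG : Measurable G)
    (hM : ∀ p, ‖G p‖ ≤ M) (hL : ∀ p, L < ‖p‖ → G p = 0) (hS : S ≠ 0) :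
    ∫⁻ ζ : ℂ × ℝ, ENNReal.ofReal (1 / (ζ.2 ^ 2 + ‖ζ.1‖ ^ 2)) * ‖Ghat c m S G ζ‖ₑ ^ 2 ≤ 
     ENNReal.ofReal (2 * Real.pi) * (ENNReal.ofReal (18 * (1 / (c * |S| * m)) ^ (1 / 3 : ℝ)) * 
      (10 * (10 * 10) * 10 * (∫⁻ p, ‖G p‖ₑ ^ (6 / 5 : ℝ)) ^ (5 / 6 : ℝ) * (∫⁻ p, ‖G p‖ₑ ^ (6 / 5 : ℝ)) ^ (5 / 6 : ℝ))) := by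
  have mGh := measurable_Ghat (c := c) (m := m) (S := S) hG
  have mP := measurable_Phi (c := c) (m := m) (S := S) hG
  have mI : Measurable fun a : ℂ => ∫⁻ τ : ℝ, ‖PhiA c m S G (a, τ)‖ₑ ^ 2 := 
    Measurable.lintegral_prod_right' (f := fun u : ℂ × ℝ => ‖PhiA c m S G u‖ₑ ^ 2) (by fun_prop)
  have mF : Measurable fun ζ : ℂ × ℝ => ENNReal.ofReal (1 / (ζ.2 ^ 2 + ‖ζ.1‖ ^ 2)) * ‖Ghat c m S G ζ‖ₑ ^ 2 := by fun_prop
  have mH : Measurable fun ζ : ℂ × ℝ => ENNReal.ofReal (1 / (1 + ‖ζ.1‖ ^ 2)) * ‖Ghat c m S G (ζ.2 • ζ.1, ζ.2)‖ₑ ^ 2 := by fun_prop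
  calc _ = ∫⁻ ρ : ℝ, ∫⁻ η : ℂ, ENNReal.ofReal (1 / (ρ ^ 2 + ‖η‖ ^ 2)) * ‖Ghat c m S G (η, ρ)‖ₑ ^ 2 := by
        rw [Measure.volume_eq_prod, lintegral_prod_symm _ mF.aemeasurable]
    _ = ∫⁻ ρ : ℝ, ∫⁻ a : ℂ, ENNReal.ofReal (1 / (1 + ‖a‖ ^ 2)) * ‖Ghat c m S G (ρ • a, ρ)‖ₑ ^ 2 := by
        apply lintegral_congr_ae
        filter_upwards [ae_ne_zero_real] with ρ hρ
        have h1 := lint_comp_smul (E := ℂ) (f := fun η : ℂ => ENNReal.ofReal (1 / (ρ ^ 2 + ‖η‖ ^ 2)) * ‖Ghat c m S G (η, ρ)‖ₑ ^ 2) 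
          (by fun_prop) hρ
        rw [Complex.finrank_real_complex, abs_of_pos (by positivity)] at h1
        have h2 : ∀ a : ℂ, ENNReal.ofReal (1 / (1 + ‖a‖ ^ 2)) * ‖Ghat c m S G (ρ • a, ρ)‖ₑ ^ 2 = 
            ENNReal.ofReal (ρ ^ 2) * (ENNReal.ofReal (1 / (ρ ^ 2 + ‖ρ • a‖ ^ 2)) * ‖Ghat c m S G (ρ • a, ρ)‖ₑ ^ 2) := by
          intro a
          rw [← mul_assoc, ← ENNReal.ofReal_mul (by positivity)]
          congr 2
          rw [norm_smul, mul_pow, Real.norm_eq_abs, sq_abs]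
          field_simp
        simp_rw [h2]
        rw [lintegral_const_mul _ (by fun_prop), h1, ← mul_assoc, ← ENNReal.ofReal_mul (by positivity), 
          mul_inv_cancel₀ (by positivity), ENNReal.ofReal_one, one_mul]
    _ = ∫⁻ a : ℂ, ∫⁻ ρ : ℝ, ENNReal.ofReal (1 / (1 + ‖a‖ ^ 2)) * ‖Ghat c m S G (ρ • a, ρ)‖ₑ ^ 2 := 
        lintegral_lintegral_swap (mH.comp measurable_swap).aemeasurable
    _ = ∫⁻ a : ℂ, ENNReal.ofReal (2 * Real.pi) * (ENNReal.ofReal (1 / (1 + ‖a‖ ^ 2)) * ∫⁻ τ : ℝ, ‖PhiA c m S G (a, τ)‖ₑ ^ 2) := by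
        congr 1; ext a
        rw [lintegral_const_mul _ (by fun_prop), mul_left_comm]
        congr 1
        obtain ⟨i1, i2⟩ := Phi_memLp (c := c) (m := m) (S := S) hL0 hG hM hL a
        rw [← plancherel_lint _ i1 i2]
        apply lintegral_congr_ae
        filter_upwards [ae_ne_zero_real] with ρ hρ
        rw [Ghat_eq hL0 hG hM hL a hρ]
    _ = ENNReal.ofReal (2 * Real.pi) * ∫⁻ a : ℂ, (ENNReal.ofReal (1 / (1 + ‖a‖ ^ 2)) * ∫⁻ τ : ℝ, ‖PhiA c m S G (a, τ)‖ₑ ^ 2) := 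
        lintegral_const_mul' _ _ ENNReal.ofReal_ne_top
    _ ≤ _ := by
        gcongr
        exact Phi_bound' hc hm hcm hL0 hG hM hL hS

end dual5


section slices
open Set

lemma slice_deriv (f : SchwartzMap (ℝ × EuclideanSpace ℝ (Fin 3)) ℂ) (t : ℝ) (n : ℕ) (x : EuclideanSpace ℝ (Fin 3)) :
    ‖iteratedFDeriv ℝ n (fun x => f (t, x)) x‖ ≤ ‖iteratedFDeriv ℝ n f (t, x)‖ := by
  have e : (fun x : EuclideanSpace ℝ (Fin 3) => f (t, x)) =
      (fun p : ℝ × EuclideanSpace ℝ (Fin 3) => f ((t, 0) + p)) ∘ (ContinuousLinearMap.inr ℝ ℝ (EuclideanSpace ℝ (Fin 3))) := by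
    ext x; simp
  have hs : ContDiff ℝ (n : ℕ∞) (fun p : ℝ × EuclideanSpace ℝ (Fin 3) => f ((t, 0) + p)) :=
    (f.smooth n).comp (contDiff_const.add contDiff_id)
  rw [e, ContinuousLinearMap.iteratedFDeriv_comp_right _ hs x (by exact_mod_cast le_rfl)]
  refine (ContinuousMultilinearMap.norm_compContinuousLinearMap_le _ _).trans ?_
  rw [iteratedFDeriv_comp_add_left]
  have h1 : ∏ _i : Fin n, ‖ContinuousLinearMap.inr ℝ ℝ (EuclideanSpace ℝ (Fin 3))‖ ≤ 1 :=
    Finset.prod_le_one (fun _ _ => norm_nonneg _) (fun _ _ => ContinuousLinearMap.norm_inr_le_one _ _ _)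
  have h2 : ((t, 0) : ℝ × EuclideanSpace ℝ (Fin 3)) + (ContinuousLinearMap.inr ℝ ℝ (EuclideanSpace ℝ (Fin 3))) x = (t, x) := by simp
  rw [h2]
  exact mul_le_of_le_one_right (norm_nonneg _) h1

lemma slice_decay (f : SchwartzMap (ℝ × EuclideanSpace ℝ (Fin 3)) ℂ) : ∃ C : ℝ, 0 ≤ C ∧ ∀ n ≤ 4, ∀ t x,
    ‖iteratedFDeriv ℝ n (fun x => f (t, x)) x‖ ≤ C * (1 + ‖t‖) ^ (-2 : ℝ) * (1 + ‖x‖) ^ (-4 : ℝ) := by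
  set C := 2 ^ 6 * ((Finset.Iic (6, 4)).sup fun m : ℕ × ℕ => SchwartzMap.seminorm ℝ m.1 m.2) f with hC
  refine ⟨C, by positivity, ?_⟩
  intro n hn t x
  have h := SchwartzMap.one_add_le_sup_seminorm_apply (𝕜 := ℝ) (m := (6, 4)) (k := 6) (n := n) le_rfl hn f (t, x)
  refine (slice_deriv f t n x).trans ?_
  have h1 : (1 + ‖t‖) ^ 2 * (1 + ‖x‖) ^ 4 ≤ (1 + ‖((t, x) : ℝ × EuclideanSpace ℝ (Fin 3))‖) ^ 6 := by
    rw [show 6 = 2 + 4 by norm_num, pow_add]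
    have := norm_fst_le ((t, x) : ℝ × EuclideanSpace ℝ (Fin 3))
    have := norm_snd_le ((t, x) : ℝ × EuclideanSpace ℝ (Fin 3))
    gcongr
  have p1 : (1 + ‖t‖) ^ (-2 : ℝ) = ((1 + ‖t‖) ^ 2)⁻¹ := by
    rw [Real.rpow_neg (by positivity)]; norm_cast
  have p2 : (1 + ‖x‖) ^ (-4 : ℝ) = ((1 + ‖x‖) ^ 4)⁻¹ := by
    rw [Real.rpow_neg (by positivity)]; norm_cast
  rw [p1, p2, mul_assoc, ← mul_inv, ← div_eq_mul_inv, le_div_iff₀ (by positivity)]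
  calc _ ≤ ‖iteratedFDeriv ℝ n f (t, x)‖ * (1 + ‖((t, x) : ℝ × EuclideanSpace ℝ (Fin 3))‖) ^ 6 := by gcongr
    _ ≤ _ := by rw [mul_comm]; exact h

lemma fourierTf_eq (g : EuclideanSpace ℝ (Fin 3) → ℂ) (ξ : EuclideanSpace ℝ (Fin 3)) :
    fourierTf g ξ = FourierTransform.fourier g ((2 * Real.pi)⁻¹ • ξ) := by
  rw [Real.fourier_eq']
  unfold fourierTf
  congr 1; ext x
  rw [smul_eq_mul, inner_smul_right]
  congr 2
  have : (Real.pi : ℂ) ≠ 0 := by exact_mod_cast Real.pi_ne_zero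
  push_cast
  field_simp

lemma fourier_slice_decay (f : SchwartzMap (ℝ × EuclideanSpace ℝ (Fin 3)) ℂ) : ∃ C : ℝ, 0 ≤ C ∧ ∀ t ξ,
    ‖fourierTf (fun x => f (t, x)) ξ‖ ≤ C * (1 + ‖t‖) ^ (-2 : ℝ) * (1 + ‖ξ‖) ^ (-4 : ℝ) := by
  obtain ⟨C, hC0, hC⟩ := slice_decay f
  have hi4 : Integrable (fun x : EuclideanSpace ℝ (Fin 3) => (1 + ‖x‖) ^ (-4 : ℝ)) := 
    integrable_one_add_norm (by simp; norm_num)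
  set J := ∫ x : EuclideanSpace ℝ (Fin 3), (1 + ‖x‖) ^ (-4 : ℝ) with hJ
  have hJ0 : 0 ≤ J := integral_nonneg (fun x => by positivity)
  have cd : ∀ t, ContDiff ℝ (4 : ℕ∞) (fun x => f (t, x)) := fun t => 
    (f.smooth 4).comp (contDiff_const.prodMk contDiff_id)
  have hIntg : ∀ t : ℝ, ∀ n ≤ 4, Integrable (fun x => ‖iteratedFDeriv ℝ n (fun x => f (t, x)) x‖) := by
    intro t n hn
    refine (hi4.const_mul (C * (1 + ‖t‖) ^ (-2 : ℝ))).mono' ?_ ?_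
    · exact (((cd t).continuous_iteratedFDeriv (m := n) (by exact_mod_cast hn)).norm).aestronglyMeasurable
    · filter_upwards with x
      rw [norm_norm]; exact hC n hn t x
  have key : ∀ t : ℝ, ∀ n ≤ 4, ∀ w, ‖w‖ ^ n * ‖FourierTransform.fourier (fun x => f (t, x)) w‖ ≤ 
      2 ^ 4 * (5 * (C * (1 + ‖t‖) ^ (-2 : ℝ) * J)) := by
    intro t n hn w
    have h := Real.pow_mul_norm_iteratedFDeriv_fourier_le (K := 0) (N := 4) (cd t) (by
      intro k n' hk hn'
      have hk0 : k = 0 := by simpa using hk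
      subst hk0
      simpa using hIntg t n' (by exact_mod_cast hn')) (k := 0) (n := n) (by simp) (by exact_mod_cast hn) w
    rw [norm_iteratedFDeriv_zero] at h
    refine h.trans ?_
    have hs : ∑ p ∈ Finset.range (0 + 1) ×ˢ Finset.range (n + 1),
        ∫ v, ‖v‖ ^ p.1 * ‖iteratedFDeriv ℝ p.2 (fun x => f (t, x)) v‖ ≤ 5 * (C * (1 + ‖t‖) ^ (-2 : ℝ) * J) := by
      have : ∀ p ∈ Finset.range (0 + 1) ×ˢ Finset.range (n + 1), 
          ∫ v, ‖v‖ ^ p.1 * ‖iteratedFDeriv ℝ p.2 (fun x => f (t, x)) v‖ ≤ (C * (1 + ‖t‖) ^ (-2 : ℝ) * J) := by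
        rintro ⟨i, j⟩ hp
        have hp' := Finset.mem_product.1 hp
        have hi : i = 0 := by simpa using hp'.1
        have hj : j < n + 1 := by simpa using hp'.2
        subst hi
        simp only [pow_zero, one_mul]
        rw [hJ, ← integral_const_mul]
        exact integral_mono (hIntg t j (by omega)) (hi4.const_mul _) (fun x => hC j (by omega) t x)
      refine (Finset.sum_le_card_nsmul _ _ _ this).trans ?_
      rw [nsmul_eq_mul]
      gcongr
      simp
      norm_cast; omega
    have hnn : 0 ≤ 5 * (C * (1 + ‖t‖) ^ (-2 : ℝ) * J) := by positivity
    have h2n : (2:ℝ) ^ n ≤ 2 ^ 4 := pow_le_pow_right₀ (by norm_num) hn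
    simp only [pow_zero, one_mul, Nat.cast_zero, mul_zero, zero_add] at *
    calc _ ≤ 2 ^ n * (5 * (C * (1 + ‖t‖) ^ (-2 : ℝ) * J)) := by gcongr
      _ ≤ _ := by gcongr
  refine ⟨8 * (1 + (2 * Real.pi) ^ 4) * (2 ^ 4 * (5 * (C * J))), by positivity, ?_⟩
  intro t ξ
  set X := ‖fourierTf (fun x => f (t, x)) ξ‖ with hX
  set T := (1 + ‖t‖) ^ (-2 : ℝ) with hT
  have hT0 : 0 ≤ T := by positivity
  have k0 := key t 0 (by norm_num) ((2 * Real.pi)⁻¹ • ξ)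
  have k4 := key t 4 (by norm_num) ((2 * Real.pi)⁻¹ • ξ)
  rw [← fourierTf_eq, ← hX] at k0 k4
  rw [norm_smul, mul_pow, Real.norm_of_nonneg (by positivity)] at k4
  have p2 : (1 + ‖ξ‖) ^ (-4 : ℝ) = ((1 + ‖ξ‖) ^ 4)⁻¹ := by
    rw [Real.rpow_neg (by positivity)]; norm_cast
  rw [p2, ← div_eq_mul_inv, le_div_iff₀ (by positivity)]
  have h8 : (1 + ‖ξ‖) ^ 4 ≤ 8 * (1 + ‖ξ‖ ^ 4) := by
    nlinarith [sq_nonneg (‖ξ‖ - 1), sq_nonneg (‖ξ‖ ^ 2 - 1), sq_nonneg (‖ξ‖ ^ 2 - ‖ξ‖), norm_nonneg ξ, sq_nonneg (‖ξ‖ + 1)]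
  have hX0 : 0 ≤ X := norm_nonneg _
  set Y := 2 ^ 4 * (5 * (C * T * J)) with hY
  have hx0 : X ≤ Y := by simpa using k0
  have hx4 : ‖ξ‖ ^ 4 * X ≤ (2 * Real.pi) ^ 4 * Y := by
    rw [inv_pow, mul_assoc, inv_mul_le_iff₀ (by positivity)] at k4
    exact k4
  calc X * (1 + ‖ξ‖) ^ 4 ≤ X * (8 * (1 + ‖ξ‖ ^ 4)) := by gcongr
    _ = 8 * (X + ‖ξ‖ ^ 4 * X) := by ring
    _ ≤ 8 * (Y + (2 * Real.pi) ^ 4 * Y) := by gcongr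
    _ = _ := by rw [hY]; ring

end slices

section transp
open Set

def e3 : EuclideanSpace ℝ (Fin 3) ≃ᵐ ℂ × ℝ :=
  ((MeasurableEquiv.toLp 2 (Fin 3 → ℝ)).symm.trans
    ((MeasurableEquiv.piFinSuccAbove (fun _ => ℝ) 2).trans MeasurableEquiv.prodComm)).trans
    (MeasurableEquiv.prodCongr ((MeasurableEquiv.finTwoArrow (α := ℝ)).trans Complex.measurableEquivRealProd.symm) (MeasurableEquiv.refl ℝ))

lemma e3_apply (x : EuclideanSpace ℝ (Fin 3)) : e3 x = (⟨x 0, x 1⟩, x 2) := by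
  rfl

lemma e3_mp : MeasurePreserving e3 volume volume := by
  refine MeasurePreserving.comp (g := MeasurableEquiv.prodCongr ((MeasurableEquiv.finTwoArrow (α := ℝ)).trans Complex.measurableEquivRealProd.symm) (MeasurableEquiv.refl ℝ)) (μb := (volume : Measure ((Fin 2 → ℝ) × ℝ))) ?_ ?_
  · exact MeasurePreserving.prod ((Complex.volume_preserving_equiv_real_prod.symm _).comp (volume_preserving_finTwoArrow ℝ)) (MeasurePreserving.id _)
  · refine MeasurePreserving.comp (g := (MeasurableEquiv.piFinSuccAbove (fun _ : Fin 3 => ℝ) 2).trans MeasurableEquiv.prodComm) (μb := (volume : Measure (Fin 3 → ℝ))) ?_ (EuclideanSpace.volume_preserving_symm_measurableEquiv_toLp (Fin 3))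
    exact (Measure.measurePreserving_swap).comp (volume_preserving_piFinSuccAbove (fun _ : Fin 3 => ℝ) 2)

def e4 : ℝ × EuclideanSpace ℝ (Fin 3) ≃ᵐ (ℝ × ℂ) × ℝ :=
  (MeasurableEquiv.prodCongr (MeasurableEquiv.refl ℝ) e3).trans MeasurableEquiv.prodAssoc.symm

lemma e4_apply (p : ℝ × EuclideanSpace ℝ (Fin 3)) : e4 p = ((p.1, ⟨p.2 0, p.2 1⟩), p.2 2) := by
  rfl

lemma e4_mp : MeasurePreserving e4 volume volume := by
  refine MeasurePreserving.comp (g := MeasurableEquiv.prodAssoc.symm) (μb := (volume : Measure (ℝ × (ℂ × ℝ)))) ?_ ?_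
  · exact (measurePreserving_prodAssoc _ _ _).symm _
  · exact MeasurePreserving.prod (MeasurePreserving.id _) e3_mp

lemma norm3 (x : EuclideanSpace ℝ (Fin 3)) : ‖x‖ ^ 2 = x 2 ^ 2 + ‖(⟨x 0, x 1⟩ : ℂ)‖ ^ 2 := by
  rw [EuclideanSpace.norm_sq_eq, Fin.sum_univ_three, ← Complex.normSq_eq_norm_sq, Complex.normSq_mk]
  simp; ring

lemma inner3 (x ξ : EuclideanSpace ℝ (Fin 3)) : ⟪x, ξ⟫ = (((⟨x 0, x 1⟩ : ℂ) * (starRingEnd ℂ) (⟨ξ 0, ξ 1⟩ : ℂ)).re + x 2 * ξ 2) := by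
  rw [PiLp.inner_apply, Fin.sum_univ_three]
  simp; ring

lemma pF_eq {F : ℝ} (hF : 1 < F) {ξ : EuclideanSpace ℝ (Fin 3)} (h : ξ ≠ 0) :
    pF F ξ = Real.sqrt ((1/F)^2 + (1 - (1/F)^2) * ξ 2 ^ 2 / (ξ 2 ^ 2 + ‖(⟨ξ 0, ξ 1⟩ : ℂ)‖ ^ 2)) := by
  have hn : 0 < ‖ξ‖ := norm_pos_iff.2 h
  have hF0 : 0 < F := by linarith
  symm
  unfold pF
  rw [Real.sqrt_eq_iff_eq_sq (by rw [← norm3]; have : (1/F)^2 ≤ 1 := by { rw [div_pow, one_pow]; rw [div_le_one (by positivity)]; nlinarith }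
                                 have : 0 ≤ 1 - (1/F)^2 := by linarith
                                 positivity) (by positivity)]
  rw [← norm3, div_pow (Real.sqrt _), Real.sq_sqrt (by positivity)]
  have h3 : ξ 0 ^ 2 + ξ 1 ^ 2 = ‖ξ‖ ^ 2 - ξ 2 ^ 2 := by
    rw [EuclideanSpace.norm_sq_eq, Fin.sum_univ_three]; simp
  rw [h3]
  field_simp
  ring

/-- the dual operator. -/
def Gt (F S : ℝ) (G : ℝ × EuclideanSpace ℝ (Fin 3) → ℂ) (ξ : EuclideanSpace ℝ (Fin 3)) : ℂ :=
  ∫ p : ℝ × EuclideanSpace ℝ (Fin 3), Complex.exp (-Complex.I * ((⟪p.2, ξ⟫ + p.1 * S * pF F ξ : ℝ) : ℂ)) * G p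

lemma Gt_eq {F S : ℝ} (hF : 1 < F) (G : ℝ × EuclideanSpace ℝ (Fin 3) → ℂ) {ξ : EuclideanSpace ℝ (Fin 3)} (h : ξ ≠ 0) :
    Gt F S G ξ = Ghat (1/F) (1 - (1/F)^2) S (fun q => G (e4.symm q)) (e3 ξ) := by
  unfold Gt Ghat
  rw [← e4_mp.integral_comp e4.measurableEmbedding]
  congr 1; ext p
  beta_reduce
  rw [e4.symm_apply_apply, e4_apply, e3_apply, inner3, pF_eq hF h]

lemma dual_transported {F S M L : ℝ} (hF : 1 < F) (hS : S ≠ 0) {G : ℝ × EuclideanSpace ℝ (Fin 3) → ℂ} (hG : Measurable G)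
    (hM : ∀ p, ‖G p‖ ≤ M) (hL0 : 0 ≤ L) (hL : ∀ p, L < ‖p‖ → G p = 0) :
    ∫⁻ ξ, ENNReal.ofReal (1/‖ξ‖^2) * ‖Gt F S G ξ‖ₑ^2 ≤ ENNReal.ofReal (2*Real.pi) * (ENNReal.ofReal (18*(1/((1/F) * |S| * (1 - (1/F)^2)))^(1/3:ℝ)) * (10*(10*10)*10 * (∫⁻ p, ‖G p‖ₑ^(6/5:ℝ))^(5/6:ℝ) * (∫⁻ p, ‖G p‖ₑ^(6/5:ℝ))^(5/6:ℝ))) := by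
  have hF0 : 0 < F := by linarith
  have h1 : (1/F)^2 < 1 := by 
    rw [div_pow, one_pow]; rw [div_lt_one (by positivity)]; nlinarith
  have hd := dual_estimate (c := 1/F) (m := 1 - (1/F)^2) (S := S) (G := fun q => G (e4.symm q)) (M := M) (L := 2 * L)
    (by positivity) (by linarith) (by linarith) (by linarith) (hG.comp e4.symm.measurable) (fun q => hM _) (by
      intro q hq
      refine hL _ ?_
      set p := e4.symm q with hp
      have hq' : q = e4 p := by rw [hp, e4.apply_symm_apply]
      by_contra hcon
      push Not at hcon
      have h1 := (norm_fst_le p).trans hcon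
      have h2 := (norm_snd_le p).trans hcon
      have h3 := norm3 p.2
      rw [hq', e4_apply] at hq
      refine absurd hq (not_lt.2 ?_)
      have h4 : |p.2 2| ≤ L := abs_le_of_sq_le_sq (by nlinarith [norm_nonneg p.2, norm_nonneg (⟨p.2 0, p.2 1⟩ : ℂ)]) hL0 |> fun h => h
      have h5 : ‖(⟨p.2 0, p.2 1⟩ : ℂ)‖ ≤ L := (abs_le_of_sq_le_sq' (by nlinarith [norm_nonneg p.2, norm_nonneg (⟨p.2 0, p.2 1⟩ : ℂ)]) hL0).2
      rw [Prod.norm_def, Prod.norm_def]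
      simp only [Real.norm_eq_abs] at *
      refine max_le (max_le ?_ ?_) ?_ <;> linarith) hS
  have e1 : ∫⁻ q, ‖G (e4.symm q)‖ₑ^(6/5:ℝ) = ∫⁻ p, ‖G p‖ₑ^(6/5:ℝ) := by
    rw [← e4_mp.lintegral_comp_emb e4.measurableEmbedding]
    simp
  simp only [e1] at hd
  refine le_trans (le_of_eq ?_) hd
  rw [← e3_mp.lintegral_comp_emb e3.measurableEmbedding]
  refine lintegral_congr (fun ξ => ?_)
  by_cases h : ξ = 0
  · subst h; simp [e3_apply]; left; rfl
  · rw [Gt_eq hF G h, e3_apply, norm3]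

end transp

section closure
open Set

lemma ennreal_absorb {A K : ℝ≥0∞} (hA : A ≠ ∞) (h : A ≤ K * A ^ (5/6:ℝ)) : A ^ (1/6:ℝ) ≤ K := by
  by_cases h0 : A = 0
  · subst h0; simp
  have e : A = A ^ (1/6:ℝ) * A ^ (5/6:ℝ) := by
    rw [← ENNReal.rpow_add _ _ h0 hA]; norm_num
  have h1 : A ^ (5/6:ℝ) ≠ 0 := by simp [ENNReal.rpow_eq_zero_iff, h0, hA]
  have h2 : A ^ (5/6:ℝ) ≠ ∞ := ENNReal.rpow_ne_top_of_nonneg (by norm_num) hA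
  refine (ENNReal.mul_le_mul_iff_left h1 h2).1 ?_
  rw [← e]; exact h

lemma duality_closure {E : Type*} [NormedAddCommGroup E] [ProperSpace E] [MeasurableSpace E] [BorelSpace E]
    (μ : Measure E) [IsFiniteMeasureOnCompacts μ] {v : E → ℂ} (hv : Measurable v) {B : ℝ} (hB : ∀ x, ‖v x‖ ≤ B) {K : ℝ≥0∞}
    (h : ∀ (G : E → ℂ) (M L : ℝ), Measurable G → (∀ x, ‖G x‖ ≤ M) → 0 ≤ L → (∀ x, L < ‖x‖ → G x = 0) →
      ‖∫ x, v x * (starRingEnd ℂ) (G x) ∂μ‖ₑ ≤ K * (∫⁻ x, ‖G x‖ₑ ^ (6/5:ℝ) ∂μ) ^ (5/6:ℝ)) :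
    eLpNorm v 6 μ ≤ K := by
  have hB0 : 0 ≤ B := (norm_nonneg _).trans (hB 0)
  have key : ∀ n : ℕ, ∫⁻ x in Metric.closedBall 0 (n:ℝ), ‖v x‖ₑ ^ (6:ℝ) ∂μ ≤ K ^ (6:ℝ) := by
    intro n
    set D := Metric.closedBall (0:E) (n:ℝ) with hD
    have hDm : MeasurableSet D := Metric.isClosed_closedBall.measurableSet
    set A := ∫⁻ x in D, ‖v x‖ₑ ^ (6:ℝ) ∂μ with hA
    set G : E → ℂ := D.indicator (fun x => ((‖v x‖ ^ 4 : ℝ) : ℂ) * v x) with hG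
    have hGm : Measurable G := Measurable.indicator (by fun_prop) hDm
    have hGM : ∀ x, ‖G x‖ ≤ B ^ 4 * B := by
      intro x
      refine (norm_indicator_le_norm_self _ _).trans ?_
      rw [norm_mul, Complex.norm_real, Real.norm_of_nonneg (by positivity)]
      have := hB x
      gcongr
    have hGL : ∀ x, (n:ℝ) < ‖x‖ → G x = 0 := by
      intro x hx
      refine indicator_of_notMem ?_ _
      simp [hD]; exact hx
    have h1 := h G _ n hGm hGM (by positivity) hGL
    have e1 : ∫⁻ x, ‖G x‖ₑ ^ (6/5:ℝ) ∂μ = A := by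
      rw [hA, ← lintegral_indicator hDm]
      refine lintegral_congr (fun x => ?_)
      by_cases hx : x ∈ D
      · rw [hG, indicator_of_mem hx, indicator_of_mem hx, enorm_mul]
        have : ‖(((‖v x‖ ^ 4 : ℝ)) : ℂ)‖ₑ = ‖v x‖ₑ ^ 4 := by
          rw [← enorm_norm (v x), ← enorm_pow]
          rw [← ofReal_norm, Complex.norm_real, ofReal_norm]
        rw [this, ← pow_succ, ← ENNReal.rpow_natCast, ← ENNReal.rpow_mul]
        norm_num
      · rw [hG, indicator_of_notMem hx, indicator_of_notMem hx]; simp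
    have hAfin : A ≠ ∞ := by
      have : A ≤ ∫⁻ x in D, (ENNReal.ofReal B) ^ (6:ℝ) ∂μ := by
        refine lintegral_mono (fun x => ?_)
        gcongr
        rw [← ofReal_norm]
        exact ENNReal.ofReal_le_ofReal (hB x)
      refine ne_top_of_le_ne_top ?_ this
      rw [setLIntegral_const]
      refine ENNReal.mul_ne_top (by simp) ?_
      exact (isCompact_closedBall _ _).measure_lt_top.ne
    have e2 : ‖∫ x, v x * (starRingEnd ℂ) (G x) ∂μ‖ₑ = A := by
      have : ∀ x, v x * (starRingEnd ℂ) (G x) = ((D.indicator (fun x => ‖v x‖ ^ 6) x : ℝ) : ℂ) := by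
        intro x
        by_cases hx : x ∈ D
        · rw [hG, indicator_of_mem hx, indicator_of_mem hx, map_mul, Complex.conj_ofReal, mul_left_comm, Complex.mul_conj,
            Complex.normSq_eq_norm_sq]
          push_cast; ring
        · rw [hG, indicator_of_notMem hx, indicator_of_notMem hx]; simp
      simp_rw [this]
      rw [integral_complex_ofReal, ← ofReal_norm, Complex.norm_real, Real.norm_of_nonneg (integral_nonneg (fun x => indicator_nonneg (fun _ _ => by positivity) _)),
        ofReal_integral_eq_lintegral_ofReal]
      · rw [hA, ← lintegral_indicator hDm]
        refine lintegral_congr (fun x => ?_)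
        by_cases hx : x ∈ D
        · rw [indicator_of_mem hx, indicator_of_mem hx, ENNReal.ofReal_pow (norm_nonneg _), ofReal_norm]
          norm_cast
        · rw [indicator_of_notMem hx, indicator_of_notMem hx]; simp
      · have hib : Integrable (fun x => (((D.indicator (fun x => ‖v x‖ ^ 6) x : ℝ)) : ℂ)) μ := by
          refine integrable_bdd (M := B ^ 6) (L := n) ?_ ?_ ?_
          · exact (Complex.measurable_ofReal.comp (Measurable.indicator (by fun_prop) hDm)).aestronglyMeasurable
          · intro x
            rw [Complex.norm_real]
            refine (norm_indicator_le_norm_self _ _).trans ?_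
            rw [Real.norm_of_nonneg (by positivity)]
            have := hB x
            gcongr
          · intro x hx
            rw [indicator_of_notMem]
            · simp
            · simp [hD]; exact hx
        exact hib.re
      · exact Filter.Eventually.of_forall (fun x => indicator_nonneg (fun _ _ => by positivity) _)
    rw [e1, e2] at h1
    have h2 := ennreal_absorb hAfin h1
    calc A = (A ^ (1/6:ℝ)) ^ (6:ℝ) := by rw [← ENNReal.rpow_mul]; norm_num
      _ ≤ _ := by gcongr
  have tot : ∫⁻ x, ‖v x‖ₑ ^ (6:ℝ) ∂μ ≤ K ^ (6:ℝ) := by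
    have hU : (⋃ n : ℕ, Metric.closedBall (0:E) (n:ℝ)) = univ := Metric.iUnion_closedBall_nat 0
    rw [← setLIntegral_univ, ← hU, setLIntegral_iUnion_of_directed]
    · exact iSup_le key
    · refine Monotone.directed_le ?_
      intro a b hab
      exact Metric.closedBall_subset_closedBall (by exact_mod_cast hab)
  rw [eLpNorm_eq_lintegral_rpow_enorm_toReal (by norm_num) (by norm_num)]
  have : (6:ℝ≥0∞).toReal = 6 := by norm_num
  rw [this]
  calc _ ≤ (K ^ (6:ℝ)) ^ (1/6:ℝ) := by gcongr
    _ = K := by rw [← ENNReal.rpow_mul]; norm_num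

end closure

section pairing
open Set

lemma pairing_fubini {X W : Type*} [MeasurableSpace X] [MeasurableSpace W] {μ : Measure X} {ν : Measure W} [SFinite μ] [SFinite ν]
    {k : X × W → ℂ} (hk : Measurable k) (hk1 : ∀ z, ‖k z‖ ≤ 1) {Φ : W → ℂ} (hΦ : Integrable Φ ν) {H : X → ℂ} (hH : Integrable H μ) :
    ‖∫ x, (∫ w, k (x, w) * Φ w ∂ν) * H x ∂μ‖ₑ ≤ ∫⁻ w, ‖Φ w‖ₑ * ‖∫ x, k (x, w) * H x ∂μ‖ₑ ∂ν := by
  have hIntg : Integrable (fun z : X × W => k z * (H z.1 * Φ z.2)) (μ.prod ν) :=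
    (hH.mul_prod hΦ).bdd_mul hk.aestronglyMeasurable (c := 1) (Filter.Eventually.of_forall hk1)
  have e : ∫ x, (∫ w, k (x, w) * Φ w ∂ν) * H x ∂μ = ∫ w, Φ w * ∫ x, k (x, w) * H x ∂μ ∂ν := by
    have e1 : ∀ x, (∫ w, k (x, w) * Φ w ∂ν) * H x = ∫ w, k (x, w) * (H x * Φ w) ∂ν := by
      intro x; rw [← integral_mul_const]; congr 1; ext w; ring
    have e2 : ∀ w, Φ w * ∫ x, k (x, w) * H x ∂μ = ∫ x, k (x, w) * (H x * Φ w) ∂μ := by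
      intro w; rw [← integral_const_mul]; congr 1; ext x; ring
    simp_rw [e1, e2]
    exact integral_integral_swap (f := fun x w => k (x, w) * (H x * Φ w)) hIntg
  rw [e]
  refine (enorm_integral_le_lintegral_enorm _).trans (le_of_eq ?_)
  simp_rw [enorm_mul]

lemma cs_weight {φ g : EuclideanSpace ℝ (Fin 3) → ℂ} (hφ : Measurable φ) (hg : AEMeasurable g) :
    ∫⁻ ξ, ‖φ ξ‖ₑ * ‖g ξ‖ₑ ≤ (∫⁻ ξ, ‖ξ‖ₑ ^ 2 * ‖φ ξ‖ₑ ^ 2) ^ (1/2:ℝ) *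
      (∫⁻ ξ : EuclideanSpace ℝ (Fin 3), ENNReal.ofReal (1/‖ξ‖^2) * ‖g ξ‖ₑ ^ 2) ^ (1/2:ℝ) := by
  have h := ENNReal.lintegral_mul_le_Lp_mul_Lq (volume : Measure (EuclideanSpace ℝ (Fin 3))) Real.HolderConjugate.two_two
    (f := fun ξ => ‖ξ‖ₑ * ‖φ ξ‖ₑ) (g := fun ξ => ENNReal.ofReal (1/‖ξ‖) * ‖g ξ‖ₑ) (by fun_prop) (by fun_prop)
  have a1 : ∀ ξ, (‖ξ‖ₑ * ‖φ ξ‖ₑ) ^ (2:ℝ) = ‖ξ‖ₑ ^ 2 * ‖φ ξ‖ₑ ^ 2 := by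
    intro ξ; rw [← mul_pow]; norm_cast
  have a2 : ∀ ξ, (ENNReal.ofReal (1/‖ξ‖) * ‖g ξ‖ₑ) ^ (2:ℝ) = ENNReal.ofReal (1/‖ξ‖^2) * ‖g ξ‖ₑ ^ 2 := by
    intro ξ
    rw [← one_div_pow, ENNReal.ofReal_pow (by positivity), ← mul_pow]; norm_cast
  simp_rw [a1, a2] at h
  refine le_trans (le_of_eq ?_) h
  refine lintegral_congr_ae ?_
  have : ∀ᵐ ξ : EuclideanSpace ℝ (Fin 3), ξ ≠ 0 := by
    rw [ae_iff]; simp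
  filter_upwards [this] with ξ hξ
  have hn : 0 < ‖ξ‖ := norm_pos_iff.2 hξ
  have : ‖ξ‖ₑ * ENNReal.ofReal (1/‖ξ‖) = 1 := by
    rw [← ofReal_norm, ← ENNReal.ofReal_mul (by positivity)]
    rw [mul_one_div_cancel hn.ne']; simp
  simp only [Pi.mul_apply]
  calc _ = 1 * (‖φ ξ‖ₑ * ‖g ξ‖ₑ) := by rw [one_mul]
    _ = _ := by rw [← this]; ring

/-- signed characteristic function of the interval from 0 to t. -/
def chi (t s : ℝ) : ℝ := (Ioc 0 t).indicator (fun _ => 1) s - (Ioc t 0).indicator (fun _ => 1) s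

lemma chi_eq (t s : ℝ) : chi t s = (if 0 < s ∧ s ≤ t then 1 else 0) - (if t < s ∧ s ≤ 0 then 1 else 0) := by
  simp [chi, indicator_apply]

lemma chi_le (t s : ℝ) : |chi t s| ≤ 1 := by
  rw [chi_eq]
  split_ifs <;> norm_num

lemma measurable_chi : Measurable (fun z : ℝ × ℝ => chi z.1 z.2) := by
  simp_rw [chi_eq]
  refine Measurable.sub ?_ ?_
  · refine Measurable.ite ?_ measurable_const measurable_const
    exact (measurableSet_lt measurable_const measurable_snd).inter (measurableSet_le measurable_snd measurable_fst)
  · refine Measurable.ite ?_ measurable_const measurable_const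
    exact (measurableSet_lt measurable_fst measurable_snd).inter (measurableSet_le measurable_snd measurable_const)

lemma interval_chi {h : ℝ → ℂ} (hh : Integrable h) (t : ℝ) : ∫ s in (0:ℝ)..t, h s = ∫ s, (chi t s : ℂ) * h s := by
  rw [intervalIntegral, ← integral_indicator measurableSet_Ioc, ← integral_indicator measurableSet_Ioc,
    ← integral_sub (hh.indicator measurableSet_Ioc) (hh.indicator measurableSet_Ioc)]
  congr 1; ext s
  rw [chi]
  by_cases h1 : s ∈ Ioc 0 t <;> by_cases h2 : s ∈ Ioc t 0 <;> simp [h1, h2]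

lemma measurable_pF (F : ℝ) : Measurable (pF F) := by
  unfold pF; fun_prop

/-- the space-time kernel. -/
def kerK (F S : ℝ) (z : (ℝ × EuclideanSpace ℝ (Fin 3)) × (ℝ × EuclideanSpace ℝ (Fin 3))) : ℂ :=
  (chi z.1.1 z.2.1 : ℂ) * Complex.exp (Complex.I * ((⟪z.1.2, z.2.2⟫ + S * (z.1.1 - z.2.1) * pF F z.2.2 : ℝ) : ℂ))

lemma measurable_kerK (F S : ℝ) : Measurable (kerK F S) := by
  unfold kerK
  have h1 : Measurable (fun z : (ℝ × EuclideanSpace ℝ (Fin 3)) × (ℝ × EuclideanSpace ℝ (Fin 3)) => chi z.1.1 z.2.1) :=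
    measurable_chi.comp (f := fun z : (ℝ × EuclideanSpace ℝ (Fin 3)) × (ℝ × EuclideanSpace ℝ (Fin 3)) => (z.1.1, z.2.1)) (by fun_prop)
  have h2 := measurable_pF F
  fun_prop

lemma norm_kerK (F S : ℝ) (z) : ‖kerK F S z‖ ≤ 1 := by
  unfold kerK
  rw [norm_mul, mul_comm Complex.I, Complex.norm_exp_ofReal_mul_I, Complex.norm_real, mul_one]
  exact chi_le _ _

lemma kerK_pair (F S : ℝ) (G : ℝ × EuclideanSpace ℝ (Fin 3) → ℂ) (w : ℝ × EuclideanSpace ℝ (Fin 3)) :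
    ‖∫ p, kerK F S (p, w) * (starRingEnd ℂ) (G p)‖ₑ = ‖Gt F S (fun p => (chi p.1 w.1 : ℂ) * G p) w.2‖ₑ := by
  have h1 : ∫ p, kerK F S (p, w) * (starRingEnd ℂ) (G p) = 
      (starRingEnd ℂ) (Complex.exp (Complex.I * ((S * w.1 * pF F w.2 : ℝ) : ℂ)) * Gt F S (fun p => (chi p.1 w.1 : ℂ) * G p) w.2) := by
    unfold Gt
    rw [← integral_const_mul, ← integral_conj]
    congr 1; ext p
    rw [← mul_assoc, ← Complex.exp_add]
    unfold kerK
    simp only [map_mul, Complex.conj_ofReal, ← Complex.exp_conj, map_add, map_neg, Complex.conj_I]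
    rw [← mul_assoc, mul_comm (chi _ _ : ℂ)]
    congr 3
    push_cast; ring
  rw [h1, RCLike.enorm_conj, enorm_mul]
  have : ‖Complex.exp (Complex.I * ((S * w.1 * pF F w.2 : ℝ) : ℂ))‖ₑ = 1 := by
    rw [← ofReal_norm, mul_comm Complex.I, Complex.norm_exp_ofReal_mul_I]; simp
  rw [this, one_mul]

end pairing

section final
open Set

/-- partial Fourier transform of a space-time function. -/
def PhiF (f : SchwartzMap (ℝ × EuclideanSpace ℝ (Fin 3)) ℂ) (w : ℝ × EuclideanSpace ℝ (Fin 3)) : ℂ :=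
  fourierTf (fun x => f (w.1, x)) w.2

lemma measurable_PhiF (f : SchwartzMap (ℝ × EuclideanSpace ℝ (Fin 3)) ℂ) : Measurable (PhiF f) := by
  unfold PhiF fourierTf
  refine StronglyMeasurable.measurable ?_
  refine StronglyMeasurable.integral_prod_right' (f := fun z : (ℝ × EuclideanSpace ℝ (Fin 3)) × EuclideanSpace ℝ (Fin 3) =>
    Complex.exp (-Complex.I * Complex.ofReal ⟪z.2, z.1.2⟫) * f (z.1.1, z.2)) ?_
  have : Continuous (fun z : (ℝ × EuclideanSpace ℝ (Fin 3)) × EuclideanSpace ℝ (Fin 3) =>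
    Complex.exp (-Complex.I * Complex.ofReal ⟪z.2, z.1.2⟫) * f (z.1.1, z.2)) := by
    have := f.continuous
    fun_prop
  exact this.stronglyMeasurable

lemma integrable_jb3 : Integrable (fun x : EuclideanSpace ℝ (Fin 3) => (1 + ‖x‖) ^ (-4 : ℝ)) := 
    integrable_one_add_norm (by simp; norm_num)

lemma integrable_jb1 : Integrable (fun x : ℝ => (1 + ‖x‖) ^ (-2 : ℝ)) := 
    integrable_one_add_norm (by simp)

lemma integrable_Phi (f : SchwartzMap (ℝ × EuclideanSpace ℝ (Fin 3)) ℂ) : Integrable (PhiF f) := by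
  obtain ⟨C, hC0, hC⟩ := fourier_slice_decay f
  have h := ((integrable_jb1.mul_prod integrable_jb3).const_mul C)
  refine Integrable.mono' h (measurable_PhiF f).aestronglyMeasurable ?_
  filter_upwards with w
  refine (hC w.1 w.2).trans (le_of_eq (by ring))

lemma sob_bound {C : ℝ} (hC0 : 0 ≤ C) {f : SchwartzMap (ℝ × EuclideanSpace ℝ (Fin 3)) ℂ}
    (hC : ∀ t ξ, ‖fourierTf (fun x => f (t, x)) ξ‖ ≤ C * (1 + ‖t‖) ^ (-2 : ℝ) * (1 + ‖ξ‖) ^ (-4 : ℝ)) (t : ℝ) (ξ : EuclideanSpace ℝ (Fin 3)) :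
    ‖ξ‖ ^ (2 * (1:ℝ)) * ‖fourierTf (fun x => f (t, x)) ξ‖ ^ 2 ≤ (C * (1 + ‖t‖) ^ (-2 : ℝ)) ^ 2 * (1 + ‖ξ‖) ^ (-4 : ℝ) := by
  have p2 : (1 + ‖ξ‖) ^ (-4 : ℝ) = ((1 + ‖ξ‖) ^ 4)⁻¹ := by
    rw [Real.rpow_neg (by positivity)]; norm_cast
  have h1 : ‖ξ‖ ^ (2 * (1:ℝ)) = ‖ξ‖ ^ 2 := by rw [mul_one]; norm_cast
  have h2 := hC t ξ
  rw [h1]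
  calc _ ≤ ‖ξ‖ ^ 2 * (C * (1 + ‖t‖) ^ (-2 : ℝ) * (1 + ‖ξ‖) ^ (-4 : ℝ)) ^ 2 := by gcongr
    _ = (C * (1 + ‖t‖) ^ (-2 : ℝ)) ^ 2 * ((1 + ‖ξ‖) ^ (-4 : ℝ) * (‖ξ‖ ^ 2 * (1 + ‖ξ‖) ^ (-4 : ℝ))) := by ring
    _ ≤ (C * (1 + ‖t‖) ^ (-2 : ℝ)) ^ 2 * ((1 + ‖ξ‖) ^ (-4 : ℝ) * 1) := by
        gcongr
        rw [p2, ← div_eq_mul_inv, div_le_one (by positivity)]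
        calc ‖ξ‖ ^ 2 ≤ (1 + ‖ξ‖) ^ 2 := by gcongr; linarith
          _ ≤ (1 + ‖ξ‖) ^ 4 := pow_le_pow_right₀ (by linarith [norm_nonneg ξ]) (by norm_num)
    _ = _ := by ring

lemma measurable_sobint (f : SchwartzMap (ℝ × EuclideanSpace ℝ (Fin 3)) ℂ) :
    Measurable (fun w : ℝ × EuclideanSpace ℝ (Fin 3) => ‖w.2‖ ^ (2 * (1:ℝ)) * ‖fourierTf (fun x => f (w.1, x)) w.2‖ ^ 2) := by
  have h : Measurable (fun w : ℝ × EuclideanSpace ℝ (Fin 3) => fourierTf (fun x => f (w.1, x)) w.2) := measurable_PhiF f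
  exact (measurable_snd.norm.pow_const _).mul (h.norm.pow_const 2)

lemma integrable_sobint (f : SchwartzMap (ℝ × EuclideanSpace ℝ (Fin 3)) ℂ) (t : ℝ) : 
    Integrable (fun ξ : EuclideanSpace ℝ (Fin 3) => ‖ξ‖ ^ (2 * (1:ℝ)) * ‖fourierTf (fun x => f (t, x)) ξ‖ ^ 2) := by
  obtain ⟨C, hC0, hC⟩ := fourier_slice_decay f
  refine (integrable_jb3.const_mul ((C * (1 + ‖t‖) ^ (-2 : ℝ)) ^ 2)).mono' ?_ ?_
  · exact ((measurable_sobint f).comp (measurable_prodMk_left (x := t))).aestronglyMeasurable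
  · filter_upwards with ξ
    rw [Real.norm_of_nonneg (by positivity)]
    exact sob_bound hC0 hC t ξ

lemma sob_nonneg (g : EuclideanSpace ℝ (Fin 3) → ℂ) : 0 ≤ sobolevNorm 1 g := by
  unfold sobolevNorm
  refine Real.rpow_nonneg (integral_nonneg (fun x => by positivity)) _

lemma integrable_sob (f : SchwartzMap (ℝ × EuclideanSpace ℝ (Fin 3)) ℂ) : 
    Integrable (fun t : ℝ => sobolevNorm 1 (fun x => f (t, x))) := by
  obtain ⟨C, hC0, hC⟩ := fourier_slice_decay f
  set J := ∫ x : EuclideanSpace ℝ (Fin 3), (1 + ‖x‖) ^ (-4 : ℝ) with hJ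
  have hJ0 : 0 ≤ J := integral_nonneg (fun x => by positivity)
  refine (integrable_jb1.const_mul (C * J ^ (1/2:ℝ))).mono' ?_ ?_
  · unfold sobolevNorm
    refine (Measurable.pow_const ?_ _).aestronglyMeasurable
    exact (StronglyMeasurable.integral_prod_right' (measurable_sobint f).stronglyMeasurable).measurable
  · filter_upwards with t
    rw [Real.norm_of_nonneg (sob_nonneg _)]
    unfold sobolevNorm
    have h1 : ∫ ξ : EuclideanSpace ℝ (Fin 3), ‖ξ‖ ^ (2 * (1:ℝ)) * ‖fourierTf (fun x => f (t, x)) ξ‖ ^ 2 ≤ (C * (1 + ‖t‖) ^ (-2 : ℝ)) ^ 2 * J := by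
      rw [hJ, ← integral_const_mul]
      exact integral_mono (integrable_sobint f t) (integrable_jb3.const_mul _) (fun ξ => sob_bound hC0 hC t ξ)
    have h0 : 0 ≤ ∫ ξ : EuclideanSpace ℝ (Fin 3), ‖ξ‖ ^ (2 * (1:ℝ)) * ‖fourierTf (fun x => f (t, x)) ξ‖ ^ 2 := integral_nonneg (fun x => by positivity)
    calc _ ≤ ((C * (1 + ‖t‖) ^ (-2 : ℝ)) ^ 2 * J) ^ (1/2:ℝ) := by gcongr
      _ = _ := by
        rw [Real.mul_rpow (by positivity) hJ0, ← Real.sqrt_eq_rpow, Real.sqrt_sq (by positivity)]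
        ring

lemma sob_lintegral (f : SchwartzMap (ℝ × EuclideanSpace ℝ (Fin 3)) ℂ) (t : ℝ) :
    (∫⁻ ξ : EuclideanSpace ℝ (Fin 3), ‖ξ‖ₑ ^ 2 * ‖PhiF f (t, ξ)‖ₑ ^ 2) ^ (1/2:ℝ) = ENNReal.ofReal (sobolevNorm 1 (fun x => f (t, x))) := by
  unfold sobolevNorm
  rw [← ENNReal.ofReal_rpow_of_nonneg (integral_nonneg (fun x => by positivity)) (by norm_num),
    ofReal_integral_eq_lintegral_ofReal (integrable_sobint f t) (Filter.Eventually.of_forall (fun x => by positivity))]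
  congr 1
  refine lintegral_congr (fun ξ => ?_)
  rw [ENNReal.ofReal_mul (by positivity), ENNReal.ofReal_pow (norm_nonneg _), ofReal_norm, mul_one,
    ← ENNReal.ofReal_rpow_of_nonneg (norm_nonneg _) (by norm_num), ofReal_norm]
  norm_cast

/-- constant in the dual estimate. -/
def CC (F S : ℝ) : ℝ≥0∞ := ENNReal.ofReal (2*Real.pi) * (ENNReal.ofReal (18*(1/((1/F) * |S| * (1 - (1/F)^2)))^(1/3:ℝ)) * (10*(10*10)*10))

lemma pairing_bound {F S M L : ℝ} (hF : 1 < F) (hS : S ≠ 0) (f : SchwartzMap (ℝ × EuclideanSpace ℝ (Fin 3)) ℂ)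
    {G : ℝ × EuclideanSpace ℝ (Fin 3) → ℂ} (hG : Measurable G)
    (hM : ∀ p, ‖G p‖ ≤ M) (hL0 : 0 ≤ L) (hL : ∀ p, L < ‖p‖ → G p = 0) :
    ‖∫ p, (∫ w, kerK F S (p, w) * PhiF f w) * (starRingEnd ℂ) (G p)‖ₑ ≤
      (ENNReal.ofReal (∫ t : ℝ, sobolevNorm 1 (fun x => f (t, x))) * (CC F S) ^ (1/2:ℝ)) * (∫⁻ p, ‖G p‖ₑ ^ (6/5:ℝ)) ^ (5/6:ℝ) := by
  set N := (∫⁻ p, ‖G p‖ₑ ^ (6/5:ℝ)) ^ (5/6:ℝ) with hN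
  have hH : Integrable (fun p => (starRingEnd ℂ) (G p)) := by
    refine integrable_bdd (M := M) (L := L) (by exact (Complex.continuous_conj.measurable.comp hG).aestronglyMeasurable) ?_ ?_
    · intro p; rw [RCLike.norm_conj]; exact hM p
    · intro p hp; rw [hL p hp]; simp
  refine (pairing_fubini (measurable_kerK F S) (norm_kerK F S) (integrable_Phi f) hH).trans ?_
  have hmI : Measurable (fun w => ∫ p, kerK F S (p, w) * (starRingEnd ℂ) (G p)) := by
    refine (StronglyMeasurable.integral_prod_left' (f := fun z : (ℝ × EuclideanSpace ℝ (Fin 3)) × (ℝ × EuclideanSpace ℝ (Fin 3)) => kerK F S z * (starRingEnd ℂ) (G z.1)) ?_).measurable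
    refine Measurable.stronglyMeasurable ?_
    exact (measurable_kerK F S).mul (Complex.continuous_conj.measurable.comp (hG.comp measurable_fst))
  have hmP := measurable_PhiF f
  have hslice : ∀ t : ℝ, ∫⁻ ξ, ‖PhiF f (t, ξ)‖ₑ * ‖∫ p, kerK F S (p, (t, ξ)) * (starRingEnd ℂ) (G p)‖ₑ ≤
      ENNReal.ofReal (sobolevNorm 1 (fun x => f (t, x))) * ((CC F S) ^ (1/2:ℝ) * N) := by
    intro t
    refine (cs_weight (φ := fun ξ => PhiF f (t, ξ)) (g := fun ξ => ∫ p, kerK F S (p, (t, ξ)) * (starRingEnd ℂ) (G p))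
      (hmP.comp measurable_prodMk_left) (hmI.comp measurable_prodMk_left).aemeasurable).trans ?_
    rw [sob_lintegral]
    gcongr
    simp_rw [kerK_pair]
    have hle : ∀ p : ℝ × EuclideanSpace ℝ (Fin 3), ‖(chi p.1 t : ℂ) * G p‖ ≤ ‖G p‖ := by
      intro p
      rw [norm_mul, Complex.norm_real]
      exact mul_le_of_le_one_left (norm_nonneg _) (chi_le _ _)
    have hd := dual_transported (M := M) (L := L) hF hS (G := fun p => (chi p.1 t : ℂ) * G p) (by
      have : Measurable (fun p : ℝ × EuclideanSpace ℝ (Fin 3) => chi p.1 t) :=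
        measurable_chi.comp (f := fun p : ℝ × EuclideanSpace ℝ (Fin 3) => (p.1, t)) (by fun_prop)
      fun_prop) (fun p => (hle p).trans (hM p)) hL0 (by
      intro p hp; rw [hL p hp, mul_zero])
    have hN' : (∫⁻ p : ℝ × EuclideanSpace ℝ (Fin 3), ‖(chi p.1 t : ℂ) * G p‖ₑ ^ (6/5:ℝ)) ^ (5/6:ℝ) ≤ N := by
      rw [hN]
      gcongr with p
      exact enorm_le_iff_norm_le.2 (hle p)
    have hd2 := hd.trans (b := _) (c := CC F S * (N * N)) (by
      unfold CC
      calc _ ≤ ENNReal.ofReal (2*Real.pi) * (ENNReal.ofReal (18*(1/((1/F) * |S| * (1 - (1/F)^2)))^(1/3:ℝ)) * (10*(10*10)*10 * N * N)) := by gcongr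
        _ = _ := by ring)
    calc _ ≤ (CC F S * (N * N)) ^ (1/2:ℝ) := by gcongr
      _ = _ := by
        rw [ENNReal.mul_rpow_of_nonneg _ _ (by norm_num), ← pow_two, ← ENNReal.rpow_natCast, ← ENNReal.rpow_mul]
        norm_num
  calc _ = ∫⁻ t, ∫⁻ ξ, ‖PhiF f (t, ξ)‖ₑ * ‖∫ p, kerK F S (p, (t, ξ)) * (starRingEnd ℂ) (G p)‖ₑ := by
        exact lintegral_prod (fun w => ‖PhiF f w‖ₑ * ‖∫ p, kerK F S (p, w) * (starRingEnd ℂ) (G p)‖ₑ) (hmP.enorm.mul hmI.enorm).aemeasurable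
    _ ≤ ∫⁻ t, ENNReal.ofReal (sobolevNorm 1 (fun x => f (t, x))) * ((CC F S) ^ (1/2:ℝ) * N) := lintegral_mono hslice
    _ = _ := by
      rw [lintegral_mul_const'' _ (integrable_sob f).aemeasurable.ennreal_ofReal,
        ofReal_integral_eq_lintegral_ofReal (integrable_sob f) (Filter.Eventually.of_forall (fun t => sob_nonneg _)), mul_assoc]

lemma v_eq (F S : ℝ) (f : SchwartzMap (ℝ × EuclideanSpace ℝ (Fin 3)) ℂ) (p : ℝ × EuclideanSpace ℝ (Fin 3)) :
    (∫ t' in (0 : ℝ)..p.1, ∫ ξ : EuclideanSpace ℝ (Fin 3), 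
      Complex.exp (Complex.I * ((⟪p.2, ξ⟫ + S * (p.1 - t') * pF F ξ : ℝ) : ℂ)) * fourierTf (fun x => f (t', x)) ξ) =
    ∫ w, kerK F S (p, w) * PhiF f w := by
  have hi := integrable_Phi f
  have i1 : Integrable (fun w : ℝ × EuclideanSpace ℝ (Fin 3) => Complex.exp (Complex.I * ((⟪p.2, w.2⟫ + S * (p.1 - w.1) * pF F w.2 : ℝ) : ℂ)) * PhiF f w) := by
    refine hi.bdd_mul (c := 1) ?_ ?_
    · have := measurable_pF F
      exact Measurable.aestronglyMeasurable (by fun_prop)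
    · filter_upwards with w
      rw [mul_comm Complex.I, Complex.norm_exp_ofReal_mul_I]
  have i2 : Integrable (fun w => kerK F S (p, w) * PhiF f w) := by
    refine hi.bdd_mul (c := 1) ?_ ?_
    · exact ((measurable_kerK F S).comp measurable_prodMk_left).aestronglyMeasurable
    · filter_upwards with w
      exact norm_kerK F S _
  rw [Measure.volume_eq_prod] at i1 i2
  have h1 := i1.integral_prod_left
  refine (interval_chi h1 p.1).trans ?_
  refine Eq.trans ?_ (integral_prod _ i2).symm
  congr 1; ext t
  rw [← integral_const_mul]
  congr 1; ext ξ
  simp only [kerK]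
  ring

lemma main_bound {F S : ℝ} (hF : 1 < F) (hS : S ≠ 0) (f : SchwartzMap (ℝ × EuclideanSpace ℝ (Fin 3)) ℂ) :
    eLpNorm (fun p => ∫ w, kerK F S (p, w) * PhiF f w) 6 volume ≤
      ENNReal.ofReal (∫ t : ℝ, sobolevNorm 1 (fun x => f (t, x))) * (CC F S) ^ (1/2:ℝ) := by
  refine duality_closure volume (B := ∫ w, ‖PhiF f w‖) ?_ ?_ ?_
  · refine (StronglyMeasurable.integral_prod_right' (f := fun z : (ℝ × EuclideanSpace ℝ (Fin 3)) × (ℝ × EuclideanSpace ℝ (Fin 3)) => kerK F S z * PhiF f z.2) ?_).measurable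
    exact ((measurable_kerK F S).mul ((measurable_PhiF f).comp measurable_snd)).stronglyMeasurable
  · intro p
    refine norm_integral_le_of_norm_le (integrable_Phi f).norm ?_
    filter_upwards with w
    rw [norm_mul]
    exact mul_le_of_le_one_left (norm_nonneg _) (norm_kerK F S _)
  · intro G M L hG hM hL0 hL
    exact pairing_bound hF hS f hG hM hL0 hL

lemma CC_bound {F ε sgn : ℝ} (hF : 1 < F) (hε : 0 < ε) (hs : sgn = 1 ∨ sgn = -1) :
    (CC F (sgn / ε)) ^ (1/2:ℝ) ≤ ENNReal.ofReal (Real.sqrt (360000 * Real.pi) * ε ^ (1 / 6 : ℝ) * F ^ (1 / 2 : ℝ) * (F - 1) ^ (-(1 / 6) : ℝ)) := by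
  have hF0 : 0 < F := by linarith
  have hF1 : 0 < F - 1 := by linarith
  have hpi := Real.pi_pos
  have habs : |sgn / ε| = 1 / ε := by
    rw [abs_div, abs_of_pos hε]
    rcases hs with h | h <;> simp [h]
  have hq : (1/((1/F) * |sgn / ε| * (1 - (1/F)^2))) ≤ ε * F ^ 3 * (F - 1)⁻¹ := by
    rw [habs]
    have : 1 - (1/F)^2 = (F - 1) * (F + 1) / F ^ 2 := by field_simp; ring
    rw [this]
    have e : (1/((1/F) * (1/ε) * ((F - 1) * (F + 1) / F ^ 2))) = ε * F ^ 3 * (F - 1)⁻¹ * (F + 1)⁻¹ := by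
      field_simp
    rw [e]
    refine mul_le_of_le_one_right (by positivity) (inv_le_one_of_one_le₀ (by linarith))
  have hm : 0 ≤ 1 - (1/F)^2 := by
    have : (1/F)^2 ≤ 1 := by { rw [div_pow, one_pow]; rw [div_le_one (by positivity)]; nlinarith }
    linarith
  have hq0 : 0 ≤ (1/((1/F) * |sgn / ε| * (1 - (1/F)^2))) := by positivity
  have h1 : CC F (sgn / ε) ≤ ENNReal.ofReal ((360000 * Real.pi) * (ε * F ^ 3 * (F - 1)⁻¹) ^ (1/3:ℝ)) := by
    unfold CC
    have h10 : (10*(10*10)*10 : ℝ≥0∞) = ENNReal.ofReal 10000 := by norm_num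
    rw [h10, ← ENNReal.ofReal_mul (by positivity), ← ENNReal.ofReal_mul (by positivity)]
    refine ENNReal.ofReal_le_ofReal ?_
    calc _ ≤ 2 * Real.pi * (18 * (ε * F ^ 3 * (F - 1)⁻¹) ^ (1/3:ℝ) * 10000) := by gcongr
      _ = _ := by ring
  calc _ ≤ (ENNReal.ofReal ((360000 * Real.pi) * (ε * F ^ 3 * (F - 1)⁻¹) ^ (1/3:ℝ))) ^ (1/2:ℝ) := by gcongr
    _ = _ := by
      rw [ENNReal.ofReal_rpow_of_nonneg (by positivity) (by norm_num)]
      congr 1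
      rw [Real.mul_rpow (by positivity) (by positivity), ← Real.sqrt_eq_rpow, ← Real.rpow_mul (by positivity),
        Real.mul_rpow (by positivity) (by positivity), Real.mul_rpow (by positivity) (by positivity),
        ← Real.rpow_natCast F 3, ← Real.rpow_mul hF0.le, Real.inv_rpow hF1.le, Real.rpow_neg hF1.le]
      norm_num
      ring

end final

theorem strichartz_primitive_inhomogeneous :
    ∃ C : ℝ, 0 < C ∧ ∀ (ε F : ℝ), 0 < ε → 1 < F → ∀ sgn : ℝ, (sgn = 1 ∨ sgn = -1) →
      ∀ f : SchwartzMap (ℝ × EuclideanSpace ℝ (Fin 3)) ℂ,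
        eLpNorm (fun p : ℝ × EuclideanSpace ℝ (Fin 3) =>
            ∫ t' in (0 : ℝ)..p.1,
              ∫ ξ : EuclideanSpace ℝ (Fin 3),
                Complex.exp (Complex.I *
                  Complex.ofReal (⟪p.2, ξ⟫ + sgn * ((p.1 - t') / ε) * pF F ξ)) *
                  fourierTf (fun x => f (t', x)) ξ) 6 volume
          ≤ ENNReal.ofReal (C * ε ^ (1 / 6 : ℝ) * F ^ (1 / 2 : ℝ) * (F - 1) ^ (-(1 / 6) : ℝ) *
              ∫ t' : ℝ, sobolevNorm 1 (fun x => f (t', x))) := by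
  refine ⟨Real.sqrt (360000 * Real.pi), by have := Real.pi_pos; positivity, ?_⟩
  intro ε F hε hF sgn hs f
  have hS : sgn / ε ≠ 0 := by
    refine div_ne_zero ?_ hε.ne'
    rcases hs with h | h <;> simp [h]
  have e : (fun p : ℝ × EuclideanSpace ℝ (Fin 3) =>
            ∫ t' in (0 : ℝ)..p.1,
              ∫ ξ : EuclideanSpace ℝ (Fin 3),
                Complex.exp (Complex.I *
                  Complex.ofReal (⟪p.2, ξ⟫ + sgn * ((p.1 - t') / ε) * pF F ξ)) *
                  fourierTf (fun x => f (t', x)) ξ) = fun p => ∫ w, kerK F (sgn / ε) (p, w) * PhiF f w := by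
    ext p
    rw [← v_eq]
    have : ∀ t' : ℝ, sgn * ((p.1 - t') / ε) = sgn / ε * (p.1 - t') := by intro t'; ring
    simp_rw [this]
  rw [e]
  refine (main_bound hF hS f).trans ?_
  have hF1 : 0 < F - 1 := by linarith
  have hF0 : 0 < F := by linarith
  rw [ENNReal.ofReal_mul (by positivity), mul_comm]
  gcongr
  exact CC_bound hF hε hs

end
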